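/- arXiv:2309.05199 — 3 statements merged into one kernel-verified Lean document; each statement's English description precedes it below -/
import Mathlib

section
/- If G is a (P₃∪P₂, K₄)-free graph, then χ(G) ≤ 7. -/
open SimpleGraph

/-- `G` contains `H`, i.e. `H` is isomorphic to an induced subgraph of `G`. -/
def Contains {V W : Type*} (G : SimpleGraph V) (H : SimpleGraph W) : Prop :=
  Nonempty (H ↪g G)

/-- The path `P₃` on 3 vertices. -/
def P3 : SimpleGraph (Fin 3) := fromEdgeSet {s(0,1), s(1,2)}

/-- The disjoint union `P₃ ∪ P₂` on 5 vertices. -/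
def P3P2 : SimpleGraph (Fin 5) := fromEdgeSet {s(0,1), s(1,2), s(3,4)}

/-- The disjoint union `K₃ ∪ P₂` on 5 vertices. -/
def K3P2 : SimpleGraph (Fin 5) := fromEdgeSet {s(0,1), s(0,2), s(1,2), s(3,4)}

/-- co-domino: the 6-cycle u₁v₁v₂v₃u₃u₂ (vertices 0 1 2 3 4 5) plus the edges
v₁v₃ and u₁u₃. -/
def coDomino : SimpleGraph (Fin 6) :=
  fromEdgeSet {s(0,1), s(1,2), s(2,3), s(3,4), s(4,5), s(5,0), s(1,3), s(0,4)}

/-- co-A: the 6-cycle u₁v₁v₂v₃u₃u₂ (vertices 0 1 2 3 4 5) plus the edges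
v₁v₃, u₁u₃ and u₁v₃. -/
def coA : SimpleGraph (Fin 6) :=
  fromEdgeSet {s(0,1), s(1,2), s(2,3), s(3,4), s(4,5), s(5,0), s(1,3), s(0,4), s(0,3)}

/-- χ37: the 6-cycle u₁v₁v₂v₃u₃u₂ (vertices 0 1 2 3 4 5) plus the single edge v₁v₃. -/
def chi37 : SimpleGraph (Fin 6) :=
  fromEdgeSet {s(0,1), s(1,2), s(2,3), s(3,4), s(4,5), s(5,0), s(1,3)}

/-- X₁: the 6-cycle v₁v₂v₃u₃u₂u₁ (vertices 0 1 2 3 4 5) plus the edge v₁v₃,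
together with a new vertex u = 6 and the edges uv₁ and uu₂. -/
def X1 : SimpleGraph (Fin 7) :=
  fromEdgeSet {s(0,1), s(1,2), s(2,3), s(3,4), s(4,5), s(5,0), s(0,2), s(6,0), s(6,4)}

/-- X₂: the 6-cycle v₁v₂v₃u₃u₂u₁ (vertices 0 1 2 3 4 5) plus the edges v₁v₃, v₃u₁, u₁u₃,
together with a new vertex u = 6 and the edges uv₂ and uu₂. -/
def X2 : SimpleGraph (Fin 7) :=
  fromEdgeSet {s(0,1), s(1,2), s(2,3), s(3,4), s(4,5), s(5,0), s(0,2), s(2,5), s(3,5),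
    s(6,1), s(6,4)}

/-- co-twin-C₅: the 5-cycle v₁v₂v₃v₄v₅ (vertices 0 1 2 3 4) plus a new vertex v₆ = 5
adjacent exactly to v₃, v₄ and v₅. -/
def coTwinC5 : SimpleGraph (Fin 6) :=
  fromEdgeSet {s(0,1), s(1,2), s(2,3), s(3,4), s(4,0), s(2,5), s(3,5), s(4,5)}

/-- `D₁ = {x : ω(G − N(x)) ≤ 2}`, where `G − N(x)` is the subgraph induced on the
vertices not adjacent to `x` (including `x` itself). -/
def D1 {V : Type*} (G : SimpleGraph V) : Set V :=
  {x : V | (G.induce {y : V | ¬ G.Adj x y}).cliqueNum ≤ 2}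

/-- `M(v)`: the set of vertices distinct from `v` and nonadjacent to `v`. -/
def Mset {V : Type*} (G : SimpleGraph V) (v : V) : Set V :=
  {u : V | u ≠ v ∧ ¬ G.Adj v u}

section Basics

variable {V : Type*} {G : SimpleGraph V}

/-- No path on three vertices of `G` is anticomplete to an edge. -/
def PathEdgeFree (G : SimpleGraph V) : Prop :=
  ∀ ⦃x y z w v : V⦄, G.Adj x y → G.Adj y z → ¬ G.Adj x z → x ≠ z → G.Adj w v →
    ¬ G.Adj w x → ¬ G.Adj w y → ¬ G.Adj w z → ¬ G.Adj v x → ¬ G.Adj v y → ¬ G.Adj v z → False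

/-- In the subgraph induced by the vertices nonadjacent to both ends of an edge, every vertex has
degree at most one. -/
def MatchingNonneighbors (G : SimpleGraph V) : Prop :=
  ∀ ⦃x y z w v : V⦄, G.Adj x y → G.Adj y z → x ≠ z → G.Adj w v →
    ¬ G.Adj w x → ¬ G.Adj w y → ¬ G.Adj w z → ¬ G.Adj v x → ¬ G.Adj v y → ¬ G.Adj v z → False

def TriangleFree (G : SimpleGraph V) : Prop :=
  ∀ ⦃x y z : V⦄, G.Adj x y → G.Adj y z → G.Adj x z → False

def TetrahedronFree (G : SimpleGraph V) : Prop :=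
  ∀ ⦃x y z w : V⦄, G.Adj x y → G.Adj x z → G.Adj x w → G.Adj y z → G.Adj y w → G.Adj z w → False

theorem pathEdgeFree_of_not_contains (h : ¬ Contains G P3P2) : PathEdgeFree G := by
  intro x y z w v hxy hyz hxz hne hwv h1 h2 h3 h4 h5 h6
  have ne : ∀ {p q r : V}, G.Adj r p → ¬ G.Adj r q → p ≠ q := by
    rintro p q r h1 h2 rfl; exact h2 h1
  apply h
  refine ⟨⟨⟨![x, y, z, w, v], ?_⟩, ?_⟩⟩
  · have e1 := hxy.ne
    have e2 := hyz.ne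
    have e3 := hwv.ne
    have e4 : x ≠ w := ne hxy.symm (fun h => h2 h.symm)
    have e5 : x ≠ v := ne hxy.symm (fun h => h5 h.symm)
    have e6 : y ≠ w := ne hxy (fun h => h1 h.symm)
    have e7 : y ≠ v := ne hxy (fun h => h4 h.symm)
    have e8 : z ≠ w := ne hyz (fun h => h2 h.symm)
    have e9 : z ≠ v := ne hyz (fun h => h5 h.symm)
    intro i j hij
    fin_cases i <;> fin_cases j <;> simp_all
  · intro i j
    have := hxy.symm
    have := hyz.symm
    have := hwv.symm
    change G.Adj (![x, y, z, w, v] i) (![x, y, z, w, v] j) ↔ P3P2.Adj i j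
    fin_cases i <;> fin_cases j <;>
      simp_all [P3P2, G.adj_comm]

theorem tetrahedronFree_of_not_contains (h : ¬ Contains G (completeGraph (Fin 4))) :
    TetrahedronFree G := by
  intro x y z w h1 h2 h3 h4 h5 h6
  apply h
  refine ⟨⟨⟨![x, y, z, w], ?_⟩, ?_⟩⟩
  · have := h1.ne
    have := h2.ne
    have := h3.ne
    have := h4.ne
    have := h5.ne
    have := h6.ne
    intro i j hij
    fin_cases i <;> fin_cases j <;> simp_all
  · intro i j
    have := h1.symm
    have := h2.symm
    have := h3.symm
    have := h4.symm
    have := h5.symm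
    have := h6.symm
    change G.Adj (![x, y, z, w] i) (![x, y, z, w] j) ↔ (completeGraph (Fin 4)).Adj i j
    fin_cases i <;> fin_cases j <;> simp_all

/-- The subgraph induced by `S` can be properly coloured with the colours below `k`. -/
def ColorableOn (G : SimpleGraph V) (S : Set V) (k : ℕ) : Prop :=
  ∃ f : V → ℕ, (∀ x ∈ S, f x < k) ∧ ∀ x ∈ S, ∀ y ∈ S, G.Adj x y → f x ≠ f y

theorem ColorableOn.mono {S T : Set V} {k l : ℕ} (h : ColorableOn G T l) (hS : S ⊆ T)
    (hk : l ≤ k) : ColorableOn G S k := by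
  obtain ⟨f, h1, h2⟩ := h
  exact ⟨f, fun x hx => (h1 x (hS hx)).trans_le hk, fun x hx y hy => h2 x (hS hx) y (hS hy)⟩

theorem ColorableOn.union {S T : Set V} {k l : ℕ} (hS : ColorableOn G S k)
    (hT : ColorableOn G T l) : ColorableOn G (S ∪ T) (k + l) := by
  classical
  obtain ⟨f, h1, h2⟩ := hS
  obtain ⟨g, h3, h4⟩ := hT
  refine ⟨fun x => if x ∈ S then f x else k + g x, ?_, ?_⟩
  · intro x hx
    by_cases hxS : x ∈ S
    · have := h1 x hxS
      simp only [hxS, if_true]; omega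
    · have := h3 x (hx.resolve_left hxS)
      simp only [hxS, if_false]; omega
  · intro x hx y hy hxy
    by_cases hxS : x ∈ S <;> by_cases hyS : y ∈ S <;> simp only [hxS, hyS, if_true, if_false]
    · exact h2 x hxS y hyS hxy
    · have := h1 x hxS
      omega
    · have := h1 y hyS
      omega
    · have := h4 x (hx.resolve_left hxS) y (hy.resolve_left hyS) hxy
      omega

theorem colorableOn_one {S : Set V} (h : ∀ x ∈ S, ∀ y ∈ S, ¬ G.Adj x y) : ColorableOn G S 1 :=
  ⟨fun _ => 0, fun _ _ => one_pos, fun x hx y hy hxy => (h x hx y hy hxy).elim⟩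

theorem ColorableOn.colorable {k : ℕ} (h : ColorableOn G Set.univ k) : G.Colorable k := by
  obtain ⟨f, h1, h2⟩ := h
  exact ⟨SimpleGraph.Coloring.mk (fun x => (⟨f x, h1 x trivial⟩ : Fin k))
    fun {x y} hxy h => h2 x trivial y trivial hxy (by simpa using h)⟩

/-- If adjacency is transitive on `S`, then greedy colouring uses at most `ω` colours. -/
theorem colorableOn_of_adj_trans [Fintype V] {S : Set V} {k : ℕ}
    (htr : ∀ x ∈ S, ∀ y ∈ S, ∀ z ∈ S, G.Adj x y → G.Adj y z → x ≠ z → G.Adj x z)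
    (hk : ∀ x ∈ S, {y | y ∈ S ∧ G.Adj x y}.ncard < k) : ColorableOn G S k := by
  classical
  let e := Fintype.equivFin V
  have key : ∀ x ∈ S, ∀ y ∈ S, G.Adj x y → e x < e y →
      {z | z ∈ S ∧ G.Adj x z ∧ e z < e x}.ncard < {z | z ∈ S ∧ G.Adj y z ∧ e z < e y}.ncard := by
    intro x hx y hy hxy hlt
    apply Set.ncard_lt_ncard _ (Set.toFinite _)
    refine ⟨?_, ?_⟩
    · rintro z ⟨hz, hxz, hzx⟩
      refine ⟨hz, htr y hy x hx z hz hxy.symm hxz ?_, hzx.trans hlt⟩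
      rintro rfl
      exact absurd (hzx.trans hlt) (lt_irrefl _)
    · intro h
      exact G.irrefl (h ⟨hx, hxy.symm, hlt⟩).2.1
  refine ⟨fun x => {z | z ∈ S ∧ G.Adj x z ∧ e z < e x}.ncard, fun x hx => ?_, ?_⟩
  · refine lt_of_le_of_lt (Set.ncard_le_ncard ?_ (Set.toFinite _)) (hk x hx)
    exact fun z hz => ⟨hz.1, hz.2.1⟩
  · intro x hx y hy hxy
    rcases lt_trichotomy (e x) (e y) with h | h | h
    · exact (key x hx y hy hxy h).ne
    · exact absurd (e.injective h) hxy.ne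
    · exact (key y hy x hx hxy.symm h).ne'

theorem colorableOn_two_of_degree_le_one [Fintype V] {S : Set V}
    (h : ∀ x ∈ S, ∀ y ∈ S, ∀ z ∈ S, G.Adj x y → G.Adj y z → x = z) : ColorableOn G S 2 := by
  apply colorableOn_of_adj_trans
  · exact fun x hx y hy z hz h1 h2 h3 => absurd (h x hx y hy z hz h1 h2) h3
  · intro x hx
    have : {y | y ∈ S ∧ G.Adj x y}.ncard ≤ 1 := by
      rw [Set.ncard_le_one_iff]
      exact fun ha hb => h _ ha.1 x hx _ hb.1 ha.2.symm hb.2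
    omega

theorem MatchingNonneighbors.colorableOn_two [Fintype V] (hF : MatchingNonneighbors G) {u v : V}
    (huv : G.Adj u v) {S : Set V} (hS : ∀ x ∈ S, ¬ G.Adj u x ∧ ¬ G.Adj v x) :
    ColorableOn G S 2 := by
  refine colorableOn_two_of_degree_le_one fun x hx y hy z hz h1 h2 => ?_
  by_contra hne
  exact hF h1 h2 hne huv (hS x hx).1 (hS y hy).1 (hS z hz).1 (hS x hx).2 (hS y hy).2 (hS z hz).2

end Basics

section Reduction

variable {V : Type*} [Fintype V] {G : SimpleGraph V}

theorem colorableOn_of_triangle_union_edge (hP : PathEdgeFree G) (hK : TetrahedronFree G)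
    {a b c z w : V} (hab : G.Adj a b) (hbc : G.Adj b c) (hac : G.Adj a c) (hzw : G.Adj z w)
    (haz : ¬ G.Adj a z) (haw : ¬ G.Adj a w) (hbz : ¬ G.Adj b z) (hbw : ¬ G.Adj b w)
    (hcz : ¬ G.Adj c z) (hcw : ¬ G.Adj c w) : ColorableOn G Set.univ 7 := by
  let Z : Set V := {x | ¬ G.Adj a x ∧ ¬ G.Adj b x ∧ ¬ G.Adj c x}
  let A (p q : V) : Set V := {x | G.Adj p x ∧ G.Adj q x}
  let O (p q r : V) : Set V := {x | G.Adj p x ∧ ¬ G.Adj q x ∧ ¬ G.Adj r x}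
  let S : Set V := O a b c ∪ O b a c ∪ O c a b
  have hA : ∀ p q, G.Adj p q → ColorableOn G (A p q) 1 := fun p q hpq =>
    colorableOn_one fun x hx y hy hxy => hK hpq hx.1 hy.1 hx.2 hy.2 hxy
  have htr : ∀ x ∈ Z, ∀ y ∈ Z, ∀ t ∈ Z, G.Adj x y → G.Adj y t → x ≠ t → G.Adj x t := by
    intro x hx y hy t ht hxy hyt hne
    by_contra hxt
    exact hP hxy hyt hxt hne hab hx.1 hy.1 ht.1 hx.2.1 hy.2.1 ht.2.1
  have touch : ∀ p q r s x y, G.Adj p q → G.Adj p r → G.Adj q r → s ∈ O p q r →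
      G.Adj x y → ¬ G.Adj p x → ¬ G.Adj q x → ¬ G.Adj r x → ¬ G.Adj p y → ¬ G.Adj q y →
      ¬ G.Adj r y → G.Adj s x ∧ G.Adj s y := by
    rintro p q r s x y hpq hpr hqr ⟨h1, h2, h3⟩ hxy px qx rx py qy ry
    have hsq : ¬ G.Adj s q := fun h => h2 h.symm
    have hne : s ≠ q := by rintro rfl; exact h3 hqr.symm
    have hor : G.Adj s x ∨ G.Adj s y := by
      by_contra! h
      exact hP h1.symm hpq hsq hne hxy (fun h' => h.1 h'.symm) (fun h' => px h'.symm)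
        (fun h' => qx h'.symm) (fun h' => h.2 h'.symm) (fun h' => py h'.symm)
        (fun h' => qy h'.symm)
    rcases hor with h | h
    · refine ⟨h, ?_⟩
      by_contra hn
      exact hP h hxy hn (by rintro rfl; exact py h1) hqr h2 qx qy h3 rx ry
    · refine ⟨?_, h⟩
      by_contra hn
      exact hP h hxy.symm hn (by rintro rfl; exact px h1) hqr h2 qy qx h3 ry rx
  have touchS : ∀ s ∈ S, ∀ x ∈ Z, ∀ y ∈ Z, G.Adj x y → G.Adj s x ∧ G.Adj s y := by
    rintro s ((hs | hs) | hs) x ⟨x1, x2, x3⟩ y ⟨y1, y2, y3⟩ hxy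
    · exact touch a b c s x y hab hac hbc hs hxy x1 x2 x3 y1 y2 y3
    · exact touch b a c s x y hab.symm hbc hac hs hxy x2 x1 x3 y2 y1 y3
    · exact touch c a b s x y hac.symm hbc.symm hab hs hxy x3 x1 x2 y3 y1 y2
  have hcover : ∀ T : Set V, S ∪ Z ⊆ T → Set.univ ⊆ A a b ∪ A b c ∪ A a c ∪ T := by
    intro T hT x _
    by_cases h1 : G.Adj a x <;> by_cases h2 : G.Adj b x <;> by_cases h3 : G.Adj c x <;>
      first
      | (left; simp [A, h1, h2, h3]; done)
      | (right; apply hT; simp [S, O, Z, h1, h2, h3])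
  have h3 := ((hA a b hab).union (hA b c hbc)).union (hA a c hac)
  by_cases hS : S.Nonempty
  · obtain ⟨s, hs⟩ := hS
    have hSstable : ColorableOn G S 1 := by
      refine colorableOn_one fun x hx y hy hxy => ?_
      have hx' := touchS x hx z ⟨haz, hbz, hcz⟩ w ⟨haw, hbw, hcw⟩ hzw
      have hy' := touchS y hy z ⟨haz, hbz, hcz⟩ w ⟨haw, hbw, hcw⟩ hzw
      exact hK hxy hx'.1 hx'.2 hy'.1 hy'.2 hzw
    have hZ : ColorableOn G Z 2 := by
      refine colorableOn_two_of_degree_le_one fun x hx y hy t ht hxy hyt => ?_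
      by_contra hne
      have h1 := touchS s hs x hx y hy hxy
      have h2 := touchS s hs y hy t ht hyt
      exact hK h1.1 h1.2 h2.2 hxy (htr x hx y hy t ht hxy hyt hne) hyt
    exact (h3.union (hSstable.union hZ)).mono (hcover _ subset_rfl) (by norm_num)
  · have hZ : ColorableOn G Z 3 := by
      refine colorableOn_of_adj_trans htr fun x hx => ?_
      by_contra! hcard
      obtain ⟨p, q, r, hp, hq, hr, hpq, hpr, hqr⟩ :=
        (Set.two_lt_ncard_iff (Set.toFinite _)).1 (Nat.lt_of_succ_le hcard)
      have hadj : ∀ p ∈ Z, ∀ q ∈ Z, G.Adj x p → G.Adj x q → p ≠ q → G.Adj p q :=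
        fun p hp q hq h1 h2 h3 => htr p hp x hx q hq h1.symm h2 h3
      exact hK hp.2 hq.2 hr.2 (hadj p hp.1 q hq.1 hp.2 hq.2 hpq)
        (hadj p hp.1 r hr.1 hp.2 hr.2 hpr) (hadj q hq.1 r hr.1 hq.2 hr.2 hqr)
    refine (h3.union hZ).mono (hcover _ ?_) (by norm_num)
    rw [Set.not_nonempty_iff_eq_empty.1 hS, Set.empty_union]

theorem PathEdgeFree.matchingNonneighbors_or_colorableOn (hP : PathEdgeFree G)
    (hK : TetrahedronFree G) : MatchingNonneighbors G ∨ ColorableOn G Set.univ 7 := by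
  by_contra! h
  apply h.1
  intro x y z w v hxy hyz hne hwv h1 h2 h3 h4 h5 h6
  by_cases hxz : G.Adj x z
  · exact h.2 (colorableOn_of_triangle_union_edge hP hK hxy hyz hxz hwv (fun h => h1 h.symm)
      (fun h => h4 h.symm) (fun h => h2 h.symm) (fun h => h5 h.symm) (fun h => h3 h.symm)
      (fun h => h6 h.symm))
  · exact hP hxy hyz hxz hne hwv h1 h2 h3 h4 h5 h6

theorem ite_ne_ite_of_disjoint (p q p' q' : Prop) [Decidable p] [Decidable q] [Decidable p']
    [Decidable q'] {m n : ℕ} (h1 : p → ¬ p') (h2 : q → ¬ q') (hmn : m ≠ n) :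
    (if p then 1 else if q then 0 else if p' then 0 else if q' then 1 else m) ≠
      (if p' then 1 else if q' then 0 else if p then 0 else if q then 1 else n) := by
  by_cases hp : p
  · simp [hp, h1 hp]
  by_cases hp' : p'
  · simp [hp, hp']
  by_cases hq : q
  · simp [hp, hp', hq, h2 hq]
  by_cases hq' : q'
  · simp [hp, hp', hq, hq']
  simpa [hp, hp', hq, hq'] using hmn

theorem exists_five_cycle (hT : TriangleFree G) (hF : MatchingNonneighbors G) {S : Set V}
    (hS : ¬ ColorableOn G S 2) :
    ∃ c : Fin 5 → V, (∀ i, c i ∈ S) ∧ ∀ i, G.Adj (c i) (c (i + 1)) := by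
  classical
  by_contra hno
  have hno : ∀ p ∈ S, ∀ q ∈ S, ∀ r ∈ S, ∀ s ∈ S, ∀ t ∈ S, G.Adj p q → G.Adj q r → G.Adj r s →
      G.Adj s t → G.Adj t p → False := by
    intro p hp q hq r hr s hs t ht h1 h2 h3 h4 h5
    refine hno ⟨![p, q, r, s, t], fun i => ?_, fun i => ?_⟩ <;> fin_cases i <;> assumption
  apply hS
  by_cases hE : ∃ u ∈ S, ∃ v ∈ S, G.Adj u v
  swap
  · push Not at hE
    exact (colorableOn_one hE).mono subset_rfl (by norm_num)
  obtain ⟨u, hu, v, hv, huv⟩ := hE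
  let R : Set V := {x | x ∈ S ∧ ¬ G.Adj u x ∧ ¬ G.Adj v x}
  obtain ⟨g, hg1, hg2⟩ := hF.colorableOn_two huv (S := R) fun x hx => hx.2
  have huniq : ∀ x ∈ R, ∀ y ∈ R, ∀ z ∈ R, G.Adj x y → G.Adj y z → x = z := by
    intro x hx y hy z hz h1 h2
    by_contra hne
    exact hF h1 h2 hne huv hx.2.1 hy.2.1 hz.2.1 hx.2.2 hy.2.2 hz.2.2
  let N (p r : V) : Prop := ∃ x ∈ S, G.Adj p x ∧ G.Adj x r
  let M (p r : V) : Prop := ∃ s ∈ R, G.Adj r s ∧ N p s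
  have hN : ∀ r ∈ R, N u r → N v r → False := by
    rintro r hr ⟨x, hx, hux, hxr⟩ ⟨y, hy, hvy, hyr⟩
    exact hno u hu x hx r hr.1 y hy v hv hux hxr hyr.symm hvy.symm huv.symm
  have hNN : ∀ p ∈ S, ∀ r ∈ R, ∀ s ∈ R, G.Adj r s → N p r → N p s → False := by
    rintro p hp r hr s hs hrs ⟨x, hx, hux, hxr⟩ ⟨y, hy, hvy, hys⟩
    exact hno p hp x hx r hr.1 s hs.1 y hy hux hxr hrs hys.symm hvy.symm
  have hM : ∀ p, ∀ r ∈ R, ∀ s ∈ R, G.Adj r s → (M p r ↔ N p s) := by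
    intro p r hr s hs hrs
    refine ⟨?_, fun h => ⟨s, hs, hrs, h⟩⟩
    rintro ⟨t, ht, hrt, h⟩
    rwa [huniq s hs r hr t ht hrs.symm hrt]
  let f (x : V) : ℕ := if G.Adj u x then 0 else if G.Adj v x then 1 else if N u x then 1 else
    if N v x then 0 else if M u x then 0 else if M v x then 1 else g x
  have hsymm : ∀ x ∈ S, ∀ y ∈ S, G.Adj x y → G.Adj u x → f x ≠ f y := by
    intro x hx y hy hxy hux
    have h1 : ¬ G.Adj u y := fun h => hT hux hxy h
    by_cases h2 : G.Adj v y
    · simp [f, hux, h1, h2]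
    · have : N u y := ⟨x, hx, hux, hxy⟩
      simp [f, hux, h1, h2, this]
  have hsymm' : ∀ x ∈ S, ∀ y ∈ S, G.Adj x y → ¬ G.Adj u x → ¬ G.Adj u y → G.Adj v x →
      f x ≠ f y := by
    intro x hx y hy hxy hux huy hvx
    have h1 : ¬ G.Adj v y := fun h => hT hvx hxy h
    have h2 : N v y := ⟨x, hx, hvx, hxy⟩
    have h3 : ¬ N u y := fun h => hN y ⟨hy, huy, h1⟩ h h2
    simp [f, hux, huy, hvx, h1, h2, h3]
  refine ⟨f, ?_, ?_⟩
  · intro x hx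
    simp only [f]
    split_ifs with h1 h2
    all_goals first | exact hg1 x ⟨hx, h1, h2⟩ | norm_num
  · intro x hx y hy hxy
    by_cases h1 : G.Adj u x
    · exact hsymm x hx y hy hxy h1
    by_cases h2 : G.Adj u y
    · exact (hsymm y hy x hx hxy.symm h2).symm
    by_cases h3 : G.Adj v x
    · exact hsymm' x hx y hy hxy h1 h2 h3
    by_cases h4 : G.Adj v y
    · exact (hsymm' y hy x hx hxy.symm h2 h1 h4).symm
    have hxR : x ∈ R := ⟨hx, h1, h3⟩
    have hyR : y ∈ R := ⟨hy, h2, h4⟩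
    have e1 := hM u x hxR y hyR hxy
    have e2 := hM v x hxR y hyR hxy
    have e3 := hM u y hyR x hxR hxy.symm
    have e4 := hM v y hyR x hxR hxy.symm
    have e5 := hNN u hu x hxR y hyR hxy
    have e6 := hNN v hv x hxR y hyR hxy
    have e7 := hg2 x hxR y hyR hxy
    simp only [f, h1, h2, h3, h4, if_false, e1, e2, e3, e4]
    exact ite_ne_ite_of_disjoint _ _ _ _ e5 e6 e7

end Reduction

/-- `K` lists the rows of an adjacency matrix as bit masks. The mask `t` is a trace that a vertex
outside `K` may leave on it: for each edge `zw` of `K` missed by `t`, the vertices of `K` nonadjacent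
to `z` and `w` meet `t` in at most one vertex, and this vertex is isolated among them. -/
def traceOK (K : List ℕ) (t : ℕ) : Bool :=
  let n := K.length
  (List.range n).all fun z => t.testBit z || (List.range z).all fun w =>
    t.testBit w || !(K.getD z 0).testBit w ||
      (let r := (2 ^ n - 1) ^^^ (K.getD z 0 ||| K.getD w 0)
       let q := t &&& r
       Nat.beq q 0 || (List.range n).all fun x =>
        !q.testBit x || (Nat.beq q (2 ^ x) && Nat.beq (K.getD x 0 &&& r) 0))

/-- Vertices with traces `s` and `t` are nonadjacent: the traces share an edge of `K`, or miss a
common nonadjacent pair. -/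
def separated (K : List ℕ) (s t : ℕ) : Bool :=
  let n := K.length
  let c := s &&& t
  let d := (2 ^ n - 1) ^^^ (s ||| t)
  (List.range n).any fun x =>
    (c.testBit x && !Nat.beq (K.getD x 0 &&& c) 0) ||
      (d.testBit x && !Nat.beq (d ^^^ (d &&& (K.getD x 0 ||| 2 ^ x))) 0)

/-- Vertices with traces `d` and `t` may be nonadjacent. -/
def nonadjOK (K : List ℕ) (d t : ℕ) : Bool :=
  let n := K.length
  (List.range n).all fun z => !d.testBit z || t.testBit z ||
    (let q := t &&& ((2 ^ n - 1) ^^^ (d ||| K.getD z 0))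
     Nat.beq q 0 || (List.range n).any fun x => Nat.beq q (2 ^ x))

def partitionOK (K : List ℕ) (P : ℕ → Bool) (C : List (List ℕ)) : Bool :=
  (List.range (2 ^ K.length)).all (fun t => !P t || !traceOK K t || C.any fun L => L.elem t) &&
    C.all fun L => L.all fun s => L.all fun t => separated K s t

def grotzsch : List ℕ := [1170, 325, 650, 1300, 585, 1984, 50, 37, 42, 52, 41]

def clebschMinusSquare : List ℕ :=
  [594, 1157, 330, 660, 2313, 960, 2085, 2090, 1076, 1065, 2818, 1232]

def branchTraces : List ℕ := [821, 1939, 555, 955]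

section Certificates

variable {V : Type*} {G : SimpleGraph V} {a : V} {K : List ℕ} {φ : ℕ → V}

/-- `φ` embeds the graph with bit mask adjacency matrix `K` into the neighbourhood of `a`. -/
structure IsCopyInNeighbors (G : SimpleGraph V) (a : V) (K : List ℕ) (φ : ℕ → V) : Prop where
  row_lt : ∀ i < K.length, K.getD i 0 < 2 ^ K.length
  adj_center : ∀ i < K.length, G.Adj a (φ i)
  adj_iff : ∀ i < K.length, ∀ j < K.length, G.Adj (φ i) (φ j) ↔ (K.getD i 0).testBit j = true
  inj : ∀ i < K.length, ∀ j < K.length, φ i = φ j → i = j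

open Classical in
/-- The bit mask of the `i < n` such that `p` is adjacent to `φ i`. -/
noncomputable def trace (G : SimpleGraph V) (φ : ℕ → V) (n : ℕ) (p : V) : ℕ :=
  Nat.ofBits fun i : Fin n => decide (G.Adj p (φ i))

theorem trace_lt (G : SimpleGraph V) (φ : ℕ → V) (n : ℕ) (p : V) : trace G φ n p < 2 ^ n :=
  Nat.ofBits_lt_two_pow _

theorem testBit_trace {n i : ℕ} {p : V} :
    (trace G φ n p).testBit i = true ↔ i < n ∧ G.Adj p (φ i) := by
  unfold trace
  by_cases h : i < n
  · simp [Nat.testBit_ofBits_lt, h]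
  · simp [Nat.testBit_ofBits_ge _ _ (not_lt.1 h), h]

theorem eq_two_pow_of_testBit {q x : ℕ} (hx : q.testBit x = true)
    (h : ∀ y, q.testBit y = true → y = x) : q = 2 ^ x := by
  refine Nat.eq_of_testBit_eq fun y => ?_
  rw [Nat.testBit_two_pow, Bool.eq_iff_iff]
  simp only [decide_eq_true_eq]
  exact ⟨fun hy => (h y hy).symm, fun hy => hy ▸ hx⟩

theorem testBit_compl (n i s : ℕ) :
    ((2 ^ n - 1) ^^^ s).testBit i = true ∧ i < n ↔ i < n ∧ s.testBit i = false := by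
  rw [Nat.testBit_xor, Nat.testBit_two_pow_sub_one]
  by_cases h : i < n <;> simp [h]

theorem IsCopyInNeighbors.traceOK_trace (hC : IsCopyInNeighbors G a K φ)
    (hF : MatchingNonneighbors G) {p : V} (hp : ¬ G.Adj a p) :
    traceOK K (trace G φ K.length p) = true := by
  set t := trace G φ K.length p with ht
  simp only [traceOK, List.all_eq_true, List.mem_range, Bool.or_eq_true, Bool.not_eq_true',
    Nat.beq_eq, Bool.and_eq_true]
  intro z hz
  refine or_iff_not_imp_left.2 fun hpz w hw => ?_
  by_cases hpw : t.testBit w = true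
  · exact Or.inl (Or.inl hpw)
  by_cases hzw : (K.getD z 0).testBit w = true
  swap
  · exact Or.inl (Or.inr (by simpa using hzw))
  refine Or.inr ?_
  have hw := hw.trans hz
  rw [ht, testBit_trace] at hpz hpw
  replace hpz : ¬ G.Adj p (φ z) := fun h => hpz ⟨hz, h⟩
  replace hpw : ¬ G.Adj p (φ w) := fun h => hpw ⟨hw, h⟩
  replace hzw := (hC.adj_iff z hz w hw).2 hzw
  set r := (2 ^ K.length - 1) ^^^ (K.getD z 0 ||| K.getD w 0) with hr
  have hr : ∀ i < K.length, r.testBit i = true → ¬ G.Adj (φ z) (φ i) ∧ ¬ G.Adj (φ w) (φ i) := by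
    intro i hi h
    have := (testBit_compl _ _ _).1 ⟨h, hi⟩
    rw [Nat.testBit_or, Bool.or_eq_false_iff] at this
    rw [hC.adj_iff z hz i hi, hC.adj_iff w hw i hi]
    exact ⟨ne_true_of_eq_false this.2.1, ne_true_of_eq_false this.2.2⟩
  have htr : ∀ i, (t &&& r).testBit i = true →
      i < K.length ∧ G.Adj p (φ i) ∧ ¬ G.Adj (φ z) (φ i) ∧ ¬ G.Adj (φ w) (φ i) := by
    intro i hi
    rw [Nat.testBit_and, Bool.and_eq_true, ht, testBit_trace] at hi
    exact ⟨hi.1.1, hi.1.2, hr i hi.1.1 hi.2⟩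
  rw [or_iff_not_imp_left]
  intro hq x hx
  obtain hqx | hqx := Bool.eq_false_or_eq_true ((t &&& r).testBit x)
  swap
  · exact Or.inl hqx
  right
  obtain ⟨-, h1, h2, h3⟩ := htr x hqx
  constructor
  · refine eq_two_pow_of_testBit hqx fun y hqy => ?_
    obtain ⟨hy, h4, h5, h6⟩ := htr y hqy
    by_contra hne
    exact hF h1.symm h4 (fun h => hne (hC.inj _ hy _ hx h.symm)) hzw h2 (fun h => hpz h.symm) h5
      h3 (fun h => hpw h.symm) h6
  · by_contra hne
    obtain ⟨y, hy⟩ := Nat.exists_testBit_of_ne_zero hne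
    rw [Nat.testBit_and, Bool.and_eq_true] at hy
    have hyn : y < K.length := by
      by_contra! h
      have := Nat.testBit_lt_two_pow ((hC.row_lt x hx).trans_le (Nat.pow_le_pow_right two_pos h))
      exact ne_true_of_eq_false this hy.1
    have h4 := hr y hyn hy.2
    have hxy := (hC.adj_iff x hx y hyn).2 hy.1
    exact hF h1 hxy (fun h => hp (h ▸ hC.adj_center y hyn)) hzw (fun h => hpz h.symm) h2 h4.1
      (fun h => hpw h.symm) h3 h4.2

theorem IsCopyInNeighbors.separated_trace (hC : IsCopyInNeighbors G a K φ)
    (hF : MatchingNonneighbors G) (hK : TetrahedronFree G) {p q : V} (hp : ¬ G.Adj a p)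
    (hq : ¬ G.Adj a q) (h : separated K (trace G φ K.length p) (trace G φ K.length q) = true) :
    ¬ G.Adj p q := by
  intro hpq
  simp only [separated, List.any_eq_true, List.mem_range, Bool.or_eq_true, Bool.and_eq_true,
    Bool.not_eq_true', Bool.eq_false_iff, ne_eq, Nat.beq_eq] at h
  obtain ⟨x, hx, ⟨h1, h2⟩ | ⟨h1, h2⟩⟩ := h
  · obtain ⟨y, hy⟩ := Nat.exists_testBit_of_ne_zero h2
    simp only [Nat.testBit_and, Bool.and_eq_true, testBit_trace] at h1 hy
    obtain ⟨h3, ⟨hyn, h4⟩, -, h5⟩ := hy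
    exact hK hpq h1.1.2 h4 h1.2.2 h5 ((hC.adj_iff x hx y hyn).2 h3)
  · obtain ⟨y, hy⟩ := Nat.exists_testBit_of_ne_zero h2
    have hmiss : ∀ i < K.length, ((2 ^ K.length - 1) ^^^ (trace G φ K.length p |||
        trace G φ K.length q)).testBit i = true → ¬ G.Adj p (φ i) ∧ ¬ G.Adj q (φ i) := by
      intro i hi h
      have h := ((testBit_compl _ _ _).1 ⟨h, hi⟩).2
      rw [Nat.testBit_or, Bool.or_eq_false_iff] at h
      exact ⟨fun h' => ne_true_of_eq_false h.1 (testBit_trace.2 ⟨hi, h'⟩),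
        fun h' => ne_true_of_eq_false h.2 (testBit_trace.2 ⟨hi, h'⟩)⟩
    rw [Nat.testBit_xor, Nat.testBit_and, Nat.testBit_or, Nat.testBit_two_pow] at hy
    have hlt := Nat.xor_lt_two_pow (Nat.sub_one_lt_of_lt (Nat.two_pow_pos K.length))
      (Nat.or_lt_two_pow (trace_lt G φ K.length p) (trace_lt G φ K.length q))
    set s := (2 ^ K.length - 1) ^^^ (trace G φ K.length p ||| trace G φ K.length q)
    have hsy : s.testBit y = true := by
      by_contra h
      simp [h] at hy
    have hyn : y < K.length := by
      by_contra! h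
      have := Nat.testBit_lt_two_pow (hlt.trans_le (Nat.pow_le_pow_right two_pos h))
      exact ne_true_of_eq_false this hsy
    simp only [hsy, Bool.true_and, Bool.true_xor, Bool.not_eq_true', Bool.or_eq_false_iff,
      decide_eq_false_iff_not] at hy
    have hxy : ¬ G.Adj (φ x) (φ y) := by
      rw [hC.adj_iff x hx y hyn]
      exact ne_true_of_eq_false hy.1
    obtain ⟨h3, h4⟩ := hmiss x hx h1
    obtain ⟨h5, h6⟩ := hmiss y hyn hsy
    exact hF (hC.adj_center x hx).symm (hC.adj_center y hyn) (fun h => hy.2 (hC.inj _ hx _ hyn h))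
      hpq h3 (fun h => hp h.symm) h5 h4 (fun h => hq h.symm) h6

theorem IsCopyInNeighbors.nonadjOK_trace (hC : IsCopyInNeighbors G a K φ)
    (hF : MatchingNonneighbors G) {d p : V} (hdp : ¬ G.Adj d p) :
    nonadjOK K (trace G φ K.length d) (trace G φ K.length p) = true := by
  simp only [nonadjOK, List.all_eq_true, List.any_eq_true, List.mem_range, Bool.or_eq_true,
    Bool.not_eq_true', Nat.beq_eq]
  intro z hz
  rw [or_assoc]
  by_cases hdz : G.Adj d (φ z)
  swap
  · exact Or.inl (Bool.eq_false_iff.2 fun h => hdz (testBit_trace.1 h).2)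
  by_cases hpz : G.Adj p (φ z)
  · exact Or.inr (Or.inl (testBit_trace.2 ⟨hz, hpz⟩))
  refine Or.inr (Or.inr (or_iff_not_imp_left.2 fun hne => ?_))
  set q := trace G φ K.length p &&& ((2 ^ K.length - 1) ^^^
    (trace G φ K.length d ||| K.getD z 0)) with hq
  have hqi : ∀ i, q.testBit i = true →
      i < K.length ∧ G.Adj p (φ i) ∧ ¬ G.Adj d (φ i) ∧ ¬ G.Adj (φ z) (φ i) := by
    intro i h
    rw [hq, Nat.testBit_and, Bool.and_eq_true, testBit_trace] at h
    obtain ⟨⟨hi, h1⟩, h2⟩ := h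
    have h2 := ((testBit_compl _ _ _).1 ⟨h2, hi⟩).2
    rw [Nat.testBit_or, Bool.or_eq_false_iff] at h2
    refine ⟨hi, h1, fun h => ne_true_of_eq_false h2.1 (testBit_trace.2 ⟨hi, h⟩), ?_⟩
    rw [hC.adj_iff z hz i hi]
    exact ne_true_of_eq_false h2.2
  obtain ⟨x, hx⟩ := Nat.exists_testBit_of_ne_zero hne
  obtain ⟨hxn, h1, h2, h3⟩ := hqi x hx
  refine ⟨x, hxn, eq_two_pow_of_testBit hx fun y hy => ?_⟩
  obtain ⟨hyn, h4, h5, h6⟩ := hqi y hy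
  by_contra hne
  exact hF h1.symm h4 (fun h => hne (hC.inj _ hyn _ hxn h.symm)) hdz h2 hdp h5 h3
    (fun h => hpz h.symm) h6

/-- A partition certificate for a set of traces colours the vertices having these traces. -/
theorem IsCopyInNeighbors.colorableOn (hC : IsCopyInNeighbors G a K φ)
    (hF : MatchingNonneighbors G) (hK : TetrahedronFree G) {P : ℕ → Bool} {C : List (List ℕ)}
    (hPC : partitionOK K P C = true)
    (hP : ∀ p, ¬ G.Adj a p → P (trace G φ K.length p) = true) :
    ColorableOn G {x | ¬ G.Adj a x} C.length := by
  simp only [partitionOK, Bool.and_eq_true, List.all_eq_true, List.any_eq_true, List.mem_range,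
    Bool.or_eq_true, Bool.not_eq_true', List.elem_eq_mem, decide_eq_true_eq] at hPC
  have hclass : ∀ p, ∃ i, ¬ G.Adj a p → ∃ h : i < C.length, trace G φ K.length p ∈ C[i] := by
    intro p
    by_cases hp : G.Adj a p
    · exact ⟨0, fun h => (h hp).elim⟩
    rcases hPC.1 _ (trace_lt G φ K.length p) with h | ⟨L, hL, hpL⟩
    · have h1 := hP p hp
      have h2 := hC.traceOK_trace hF hp
      simp_all
    · obtain ⟨i, hi, rfl⟩ := List.getElem_of_mem hL
      exact ⟨i, fun _ => ⟨hi, hpL⟩⟩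
  choose f hf using hclass
  refine ⟨f, fun x hx => (hf x hx).1, fun x hx y hy hxy hfxy => ?_⟩
  obtain ⟨hx', hx1⟩ := hf x hx
  obtain ⟨hy', hy1⟩ := hf y hy
  simp only [← hfxy] at hy1
  exact hC.separated_trace hF hK hx hy (hPC.2 _ (List.getElem_mem hx') _ hx1 _ hy1) hxy

end Certificates

section NeighborhoodStructure

variable {W : Type*} {H : SimpleGraph W}

theorem adj_iff_of_five_cycle (hT : TriangleFree H) {c : Fin 5 → W}
    (hc : ∀ i, H.Adj (c i) (c (i + 1))) (i j : Fin 5) :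
    H.Adj (c i) (c j) ↔ j = i + 1 ∨ j = i + 4 := by
  have h4 : ∀ i, H.Adj (c i) (c (i + 4)) := fun i => by
    have := (hc (i + 4)).symm
    rwa [add_assoc, show (4 + 1 : Fin 5) = 0 from rfl, add_zero] at this
  refine ⟨fun h => ?_, by rintro (rfl | rfl); exacts [hc i, h4 i]⟩
  have cases : ∀ i j : Fin 5, j = i + 1 ∨ j = i + 4 ∨ j = i ∨ j = i + 1 + 1 ∨ j = i + 4 + 4 := by
    decide
  rcases cases i j with h1 | h1 | h1 | h1 | h1
  · exact Or.inl h1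
  · exact Or.inr h1
  · subst h1
    exact absurd rfl h.ne
  · subst h1
    exact (hT (hc i) (hc (i + 1)) h).elim
  · subst h1
    exact (hT (h4 i) (h4 (i + 4)) h).elim

theorem exists_type_of_five_cycle (hT : TriangleFree H) (hF : MatchingNonneighbors H)
    {c : Fin 5 → W} (hc : ∀ i, H.Adj (c i) (c (i + 1))) {o x : W} (ho : ∀ i, ¬ H.Adj o (c i))
    (hx : H.Adj o x) : ∃ i, ∀ j, H.Adj x (c j) ↔ j = i + 1 ∨ j = i + 4 := by
  classical
  have key : ∀ b : Fin 5 → Bool, (∀ j, ¬ (b j = true ∧ b (j + 1) = true)) →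
      (∀ j, b j = true ∨ b (j + 1) = true ∨ b (j + 1 + 1) = true) →
      ∃ i, ∀ j, b j = true ↔ j = i + 1 ∨ j = i + 4 := by decide
  have := key (fun j => decide (H.Adj x (c j)))
  simp only [decide_eq_true_eq] at this
  refine this (fun j h => hT h.1 (hc j) h.2) fun j => ?_
  by_contra! h
  have hne : c j ≠ c (j + 1 + 1) := fun e => by
    have h1 : H.Adj (c j) (c (j + 1 + 1 + 1)) := e ▸ hc (j + 1 + 1)
    rw [adj_iff_of_five_cycle hT hc] at h1
    revert h1
    clear * -
    decide +revert
  exact hF (hc j) (hc (j + 1)) hne hx (ho _) (ho _) (ho _) h.1 h.2.1 h.2.2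

theorem eq_of_type_eq (hF : MatchingNonneighbors H) {c : Fin 5 → W}
    (hc : ∀ i, H.Adj (c i) (c (i + 1))) {o x y : W} (ho : ∀ i, ¬ H.Adj o (c i))
    (hx : H.Adj o x) (hy : H.Adj o y) {i : Fin 5}
    (hxi : ∀ j, H.Adj x (c j) ↔ j = i + 1 ∨ j = i + 4)
    (hyi : ∀ j, H.Adj y (c j) ↔ j = i + 1 ∨ j = i + 4) : x = y := by
  have h2 : ¬ (i + 2 = i + 1 ∨ i + 2 = i + 4) := by clear * -; decide +revert
  have h3 : ¬ (i + 2 + 1 = i + 1 ∨ i + 2 + 1 = i + 4) := by clear * -; decide +revert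
  by_contra hne
  exact hF hx.symm hy hne (hc (i + 2)) (fun h => h2 ((hxi _).1 h.symm))
    (fun h => ho _ h.symm) (fun h => h2 ((hyi _).1 h.symm)) (fun h => h3 ((hxi _).1 h.symm))
    (fun h => ho _ h.symm) (fun h => h3 ((hyi _).1 h.symm))

/-- A five-cycle `c` together with a vertex `o` having exactly four neighbours, the `u i` for
`i ≠ 0`, such that the neighbours of `c 0`, `c 2` and `c 3` are known. -/
structure FourSpokes (H : SimpleGraph W) (c u : Fin 5 → W) (o : W) : Prop where
  cycle : ∀ i j, H.Adj (c i) (c j) ↔ j = i + 1 ∨ j = i + 4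
  center : ∀ i, ¬ H.Adj o (c i)
  adj_center : ∀ i, i ≠ 0 → H.Adj o (u i)
  adj_cycle : ∀ i, i ≠ 0 → ∀ j, H.Adj (u i) (c j) ↔ j = i + 1 ∨ j = i + 4
  nbr_center : ∀ x, H.Adj o x → ∃ i, i ≠ 0 ∧ x = u i
  nbr_cycle : ∀ j, j ≠ 1 → j ≠ 4 → ∀ x, H.Adj (c j) x →
    x = c (j + 1) ∨ x = c (j + 4) ∨ x = u (j + 1) ∨ x = u (j + 4)

theorem FourSpokes.reflect {c u : Fin 5 → W} {o : W} (h : FourSpokes H c u o) :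
    FourSpokes H (fun i => c (-i)) (fun i => u (-i)) o where
  cycle i j := (h.cycle _ _).trans (by decide +revert)
  center i := h.center _
  adj_center i hi := h.adj_center _ (neg_ne_zero.2 hi)
  adj_cycle i hi j := (h.adj_cycle _ (neg_ne_zero.2 hi) _).trans (by clear * -; decide +revert)
  nbr_center x hx := by
    obtain ⟨i, hi, rfl⟩ := h.nbr_center x hx
    exact ⟨-i, neg_ne_zero.2 hi, by rw [neg_neg]⟩
  nbr_cycle j h1 h4 x hx := by
    have e1 : -(j + 1) = -j + 4 := by clear * -; decide +revert
    have e4 : -(j + 4) = -j + 1 := by clear * -; decide +revert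
    have := h.nbr_cycle (-j) (by clear hx; decide +revert) (by clear hx; decide +revert) x hx
    simp only [e1, e4]
    tauto

variable {c u : Fin 5 → W} {o : W}

theorem FourSpokes.exists_adj_of_not_colorableOn (h : FourSpokes H c u o) (hT : TriangleFree H)
    (hF : MatchingNonneighbors H) (hcol : ¬ ColorableOn H {x | ¬ H.Adj (c 2) x} 2) :
    ∃ b, H.Adj (c 4) b ∧ ¬ H.Adj (c 1) b ∧ b ≠ c 3 ∧ b ≠ u 3 := by
  classical
  by_contra! hno
  have hc := fun i j => (h.cycle i j).2
  have hc' := fun i j => mt (h.cycle i j).1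
  have hu := fun i j hi hj => ((h.adj_cycle i hi j).2 hj).symm
  have hu' := fun i j hi => mt (h.adj_cycle i hi j).1
  let A : Set W := {x | ¬ H.Adj (c 2) x ∧ (x = o ∨ H.Adj (c 1) x ∧ x ≠ u 2)}
  let B : Set W := {x | ¬ H.Adj (c 2) x ∧ x ≠ o ∧ (¬ H.Adj (c 1) x ∨ x = u 2)}
  have hA : ColorableOn H A 1 := by
    have hoA : ∀ x ∈ A, ¬ H.Adj o x := by
      rintro x ⟨h2, rfl | ⟨h3, h4⟩⟩ hox
      · exact hox.ne rfl
      · obtain ⟨i, hi, rfl⟩ := h.nbr_center x hox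
        fin_cases i
        · exact hi rfl
        · exact h2 (hu 1 2 (by decide) (by decide))
        · exact h4 rfl
        · exact h2 (hu 3 2 (by decide) (by decide))
        · exact hu' 4 1 (by decide) (by decide) h3.symm
    refine colorableOn_one fun x hx y hy hxy => ?_
    rcases hx.2 with rfl | ⟨hx1, -⟩
    · exact hoA y hy hxy
    rcases hy.2 with rfl | ⟨hy1, -⟩
    · exact hoA x hx hxy.symm
    exact hT hx1 hxy hy1
  have hB : ColorableOn H B 1 := by
    have hclass : ∀ x ∈ B, x = u 2 ∨ x = u 4 ∨ x = c 4 ∨ ∀ j, ¬ H.Adj (c j) x := by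
      rintro x ⟨h2, h3, h1⟩
      by_cases hxu : x = u 2
      · exact Or.inl hxu
      have h1 := h1.resolve_right hxu
      right
      by_cases h0 : H.Adj (c 0) x
      · rcases h.nbr_cycle 0 (by decide) (by decide) x h0 with rfl | rfl | rfl | rfl
        · exact (h2 (hc 2 1 (by decide))).elim
        · exact Or.inr (Or.inl rfl)
        · exact (h2 (hu 1 2 (by decide) (by decide))).elim
        · exact Or.inl rfl
      by_cases h3 : H.Adj (c 3) x
      · rcases h.nbr_cycle 3 (by decide) (by decide) x h3 with rfl | rfl | rfl | rfl
        · exact Or.inr (Or.inl rfl)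
        · exact (h1 (hc 1 2 (by decide))).elim
        · exact Or.inl rfl
        · exact (hxu rfl).elim
      by_cases h4 : H.Adj (c 4) x
      · by_cases hx3 : x = c 3
        · exact (h2 (hx3 ▸ hc 2 3 (by decide))).elim
        · have := hno x h4 h1 hx3
          exact (h2 (this ▸ hu 3 2 (by decide) (by decide))).elim
      refine Or.inr (Or.inr fun j => ?_)
      fin_cases j <;> assumption
    have hiso : ∀ x, x ≠ o → (∀ j, ¬ H.Adj (c j) x) → ∀ y ∈ B, ¬ H.Adj x y := by
      intro x hxo hx y hy hxy
      have hxu : ∀ i, i ≠ 0 → x = u i ∨ y = u i → False := by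
        rintro i hi (rfl | rfl)
        · exact hx (i + 1) (hu i _ hi (Or.inl rfl))
        · have e2 : ¬ (i + 2 = i + 1 ∨ i + 2 = i + 4) := by clear * -; decide +revert
          have e3 : ¬ (i + 3 = i + 1 ∨ i + 3 = i + 4) := by clear * -; decide +revert
          have e : i + 3 = i + 2 + 1 ∨ i + 3 = i + 2 + 4 := by clear * -; decide +revert
          exact hF (h.adj_center i hi) hxy.symm hxo.symm (hc _ _ e) (fun h' => h.center _ h'.symm)
            (fun h' => hu' i _ hi e2 h'.symm) (hx _) (fun h' => h.center _ h'.symm)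
            (fun h' => hu' i _ hi e3 h'.symm) (hx _)
      rcases hclass y hy with rfl | rfl | rfl | hy'
      · exact hxu 2 (by decide) (Or.inr rfl)
      · exact hxu 4 (by decide) (Or.inr rfl)
      · exact hx 4 hxy.symm
      · exact hF (hc 0 1 (by decide)) (hc 1 2 (by decide))
          (fun e => hc' 0 3 (by decide) (e ▸ hc 2 3 (by decide))) hxy (fun h => hx _ h.symm)
          (fun h => hx _ h.symm) (fun h => hx _ h.symm) (fun h => hy' _ h.symm)
          (fun h => hy' _ h.symm) (fun h => hy' _ h.symm)
    have hu24 : ¬ H.Adj (u 2) (u 4) := fun h' =>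
      hT (h.adj_center 2 (by decide)) h' (h.adj_center 4 (by decide))
    have hu2 := hu' 2 4 (by decide) (by decide)
    have hu4 := hu' 4 4 (by decide) (by decide)
    refine colorableOn_one fun x hx y hy hxy => ?_
    rcases hclass x hx with rfl | rfl | rfl | hx'
    rotate_right
    · exact hiso x hx.2.1 hx' y hy hxy
    all_goals
      rcases hclass y hy with rfl | rfl | rfl | hy'
      rotate_right
      · exact hiso y hy.2.1 hy' _ hx hxy.symm
    all_goals first | exact hxy.ne rfl | exact hu24 hxy | exact hu24 hxy.symm | exact hu2 hxy |
      exact hu2 hxy.symm | exact hu4 hxy | exact hu4 hxy.symm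
  refine hcol ((hA.union hB).mono (fun x hx => ?_) le_rfl)
  by_cases h1 : x = o ∨ H.Adj (c 1) x ∧ x ≠ u 2
  · exact Or.inl ⟨hx, h1⟩
  · exact Or.inr ⟨hx, by tauto⟩

theorem FourSpokes.adj_iff_of_adj (h : FourSpokes H c u o) (hT : TriangleFree H)
    (hF : MatchingNonneighbors H) {b : W} (h1 : H.Adj (c 1) b) (h4 : ¬ H.Adj (c 4) b)
    (hb2 : b ≠ c 2) (hbu : b ≠ u 2) :
    (∀ j, H.Adj b (c j) ↔ j = 1) ∧ ¬ H.Adj b o ∧ ∀ i, i ≠ 0 → (H.Adj b (u i) ↔ i = 3 ∨ i = 4) := by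
  have hc := fun i j => (h.cycle i j).2
  have hc' := fun i j => mt (h.cycle i j).1
  have hu := fun i j hi hj => ((h.adj_cycle i hi j).2 hj).symm
  have hu' := fun i j hi => mt (h.adj_cycle i hi j).1
  have h0 : ¬ H.Adj b (c 0) := fun h0 => hT h1 h0 (hc 1 0 (by decide))
  have h2 : ¬ H.Adj b (c 2) := fun h2 => hT h1 h2 (hc 1 2 (by decide))
  have h3 : ¬ H.Adj b (c 3) := fun h3 => by
    rcases h.nbr_cycle 3 (by decide) (by decide) b h3.symm with rfl | rfl | rfl | rfl
    · exact hc' 1 4 (by decide) h1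
    · exact hb2 rfl
    · exact hu' 4 1 (by decide) (by decide) h1.symm
    · exact hbu rfl
  have h4' : ¬ H.Adj b (c 4) := fun h => h4 h.symm
  have ho : ¬ H.Adj b o := fun hob => by
    obtain ⟨i, hi, rfl⟩ := h.nbr_center b hob.symm
    have := (h.adj_cycle i hi 1).1 h1.symm
    have : i = 2 := by
      clear * - this hi
      decide +revert
    exact hbu (this ▸ rfl)
  have hb0 : c 0 ≠ b := by
    rintro rfl
    exact h4' (hc 0 4 (by decide))
  refine ⟨fun j => ?_, ho, fun i hi => ?_⟩
  · fin_cases j <;> simp [h0, h2, h3, h4', h1.symm]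
  · have hu3 : H.Adj b (u 3) := by
      by_contra hn
      exact hF (hc 0 1 (by decide)) h1 hb0 (h.adj_center 3 (by decide)) (h.center _) (h.center _)
        (fun h => ho h.symm) (hu' 3 0 (by decide) (by decide)) (hu' 3 1 (by decide) (by decide))
        (fun h => hn h.symm)
    have hu4 : H.Adj b (u 4) := by
      by_contra hn
      exact hF h1.symm (hc 1 2 (by decide)) hb2 (h.adj_center 4 (by decide)) (fun h => ho h.symm)
        (h.center _) (h.center _) (fun h => hn h.symm) (hu' 4 1 (by decide) (by decide))
        (hu' 4 2 (by decide) (by decide))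
    have hu2 : ¬ H.Adj b (u 2) := fun h2 => hT h1 h2 (hu 2 1 (by decide) (by decide))
    have hu1 : ¬ H.Adj b (u 1) := fun h' => by
      have hob : o ≠ b := by
        rintro rfl
        exact h.center 1 h1.symm
      exact hF (h.adj_center 1 (by decide)) h'.symm hob (hc 3 4 (by decide))
        (fun h' => h.center _ h'.symm) (fun h' => hu' 1 3 (by decide) (by decide) h'.symm)
        (fun h => h3 h.symm) (fun h' => h.center _ h'.symm)
        (fun h' => hu' 1 4 (by decide) (by decide) h'.symm) h4
    fin_cases i <;> simp_all

/-- Two further vertices attached to the opposite ends of `c 1`, `c 0`, `c 4`. -/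
theorem FourSpokes.exists_pair (h : FourSpokes H c u o) (hT : TriangleFree H)
    (hF : MatchingNonneighbors H) (hcol : ∀ v, ¬ ColorableOn H {x | ¬ H.Adj v x} 2) :
    ∃ b b', H.Adj b b' ∧
      ((∀ j, H.Adj b (c j) ↔ j = 1) ∧ ¬ H.Adj b o ∧
        ∀ i, i ≠ 0 → (H.Adj b (u i) ↔ i = 3 ∨ i = 4)) ∧
      ((∀ j, H.Adj b' (c j) ↔ j = 4) ∧ ¬ H.Adj b' o ∧
        ∀ i, i ≠ 0 → (H.Adj b' (u i) ↔ i = 2 ∨ i = 1)) := by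
  obtain ⟨b', h1, h2, h3, h4⟩ := h.exists_adj_of_not_colorableOn hT hF (hcol _)
  obtain ⟨b, h5, h6, h7, h8⟩ := h.reflect.exists_adj_of_not_colorableOn hT hF (hcol _)
  have hb := h.adj_iff_of_adj hT hF h5 h6 h7 h8
  have hb' := h.reflect.adj_iff_of_adj hT hF h1 h2 h3 h4
  refine ⟨b, b', ?_, hb, fun j => ?_, hb'.2.1, fun i hi => ?_⟩
  · by_contra hn
    exact hF h5.symm ((h.cycle 1 2).2 (by decide)) h7 h1 h6 (mt (h.cycle 4 1).1 (by decide))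
      (mt (h.cycle 4 2).1 (by decide)) (fun h => hn h.symm) (fun h => h2 h.symm)
      (fun h => by simpa using (hb'.1 3).1 h)
  · have := hb'.1 (-j)
    simp only [neg_neg] at this
    rw [this]
    clear * -
    decide +revert
  · have := hb'.2.2 (-i) (neg_ne_zero.2 hi)
    simp only [neg_neg] at this
    rw [this]
    clear * -
    decide +revert

theorem FourSpokes.exists_clebschMinusSquare (h : FourSpokes H c u o) (hT : TriangleFree H)
    (hF : MatchingNonneighbors H) (hcol : ∀ v, ¬ ColorableOn H {x | ¬ H.Adj v x} 2) :
    ∃ ψ : Fin 12 → W, ∀ i j, H.Adj (ψ i) (ψ j) ↔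
      (clebschMinusSquare.getD i 0).testBit j = true := by
  obtain ⟨b, b', hbb, ⟨hb, hbo, hbu⟩, hb', hbo', hbu'⟩ := h.exists_pair hT hF hcol
  refine ⟨![c 0, c 1, c 2, c 3, c 4, o, u 1, u 2, u 3, u 4, b, b'], fun i j => ?_⟩
  have hu := fun i hi j => h.adj_cycle i hi j
  have hco : ∀ i, ¬ H.Adj (c i) o := fun i h' => h.center i h'.symm
  have huo : ∀ i, i ≠ 0 → H.Adj (u i) o := fun i hi => (h.adj_center i hi).symm
  have hcu : ∀ i j, i ≠ 0 → (H.Adj (c j) (u i) ↔ j = i + 1 ∨ j = i + 4) :=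
    fun i j hi => (H.adj_comm _ _).trans (h.adj_cycle i hi j)
  have huu : ∀ i j, i ≠ 0 → j ≠ 0 → ¬ H.Adj (u i) (u j) := fun i j hi hj h' =>
    hT (h.adj_center i hi) h' (h.adj_center j hj)
  have hcb : ∀ j, H.Adj (c j) b ↔ j = 1 := fun j => (H.adj_comm _ _).trans (hb j)
  have hcb' : ∀ j, H.Adj (c j) b' ↔ j = 4 := fun j => (H.adj_comm _ _).trans (hb' j)
  have hub : ∀ i, i ≠ 0 → (H.Adj (u i) b ↔ i = 3 ∨ i = 4) :=
    fun i hi => (H.adj_comm _ _).trans (hbu i hi)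
  have hub' : ∀ i, i ≠ 0 → (H.Adj (u i) b' ↔ i = 2 ∨ i = 1) :=
    fun i hi => (H.adj_comm _ _).trans (hbu' i hi)
  have hob : ¬ H.Adj o b := fun h' => hbo h'.symm
  have hob' : ¬ H.Adj o b' := fun h' => hbo' h'.symm
  fin_cases i <;> fin_cases j <;>
    simp [clebschMinusSquare, h.cycle, h.center, h.adj_center, h.adj_cycle, hco, huo, hcu, huu,
      hb, hb', hbo, hbo', hbu, hbu', hcb, hcb', hub, hub', hob, hob', hbb, hbb.symm,
      Nat.testBit_eq_decide_div_mod_eq]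

theorem exists_grotzsch (hT : TriangleFree H)
    (hcycle : ∀ i j, H.Adj (c i) (c j) ↔ j = i + 1 ∨ j = i + 4)
    (ho : ∀ i, ¬ H.Adj o (c i)) (hou : ∀ i, H.Adj o (u i))
    (huc : ∀ i j, H.Adj (u i) (c j) ↔ j = i + 1 ∨ j = i + 4) :
    ∃ ψ : Fin 11 → W, ∀ i j, H.Adj (ψ i) (ψ j) ↔ (grotzsch.getD i 0).testBit j = true := by
  refine ⟨![c 0, c 1, c 2, c 3, c 4, o, u 0, u 1, u 2, u 3, u 4], fun i j => ?_⟩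
  have hco : ∀ i, ¬ H.Adj (c i) o := fun i h' => ho i h'.symm
  have huo : ∀ i, H.Adj (u i) o := fun i => (hou i).symm
  have hcu : ∀ i j, H.Adj (c j) (u i) ↔ j = i + 1 ∨ j = i + 4 :=
    fun i j => (H.adj_comm _ _).trans (huc i j)
  have huu : ∀ i j, ¬ H.Adj (u i) (u j) := fun i j h' => hT (hou i) h' (hou j)
  fin_cases i <;> fin_cases j <;>
    simp [grotzsch, hcycle, ho, hou, huc, hco, huo, hcu, huu, Nat.testBit_eq_decide_div_mod_eq]

end NeighborhoodStructure

section NeighborhoodDichotomy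

variable {W : Type*} {H : SimpleGraph W}

/-- Chasing degrees from a vertex of maximum degree yields one of two small graphs. -/
theorem exists_grotzsch_or_clebschMinusSquare [Finite W] [Nonempty W] (hT : TriangleFree H)
    (hF : MatchingNonneighbors H) (hcol : ∀ v, ¬ ColorableOn H {x | ¬ H.Adj v x} 2) :
    (∃ ψ : Fin 11 → W, ∀ i j, H.Adj (ψ i) (ψ j) ↔ (grotzsch.getD i 0).testBit j = true) ∨
    ∃ ψ : Fin 12 → W, ∀ i j, H.Adj (ψ i) (ψ j) ↔
      (clebschMinusSquare.getD i 0).testBit j = true := by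
  classical
  have := Fintype.ofFinite W
  let N (v : W) : Finset W := Finset.univ.filter (H.Adj v)
  have memN : ∀ {v x}, x ∈ N v ↔ H.Adj v x := by simp [N]
  obtain ⟨o, -, hmax⟩ := Finset.exists_max_image Finset.univ (fun v => (N v).card)
    ⟨Classical.arbitrary W, Finset.mem_univ _⟩
  obtain ⟨c, ho, hc⟩ := exists_five_cycle hT hF (hcol o)
  simp only [Set.mem_ofPred_eq] at ho
  have hcc := adj_iff_of_five_cycle hT hc
  have hex : ∃ (I : Finset (Fin 5)) (u : Fin 5 → W),
      (∀ i ∈ I, H.Adj o (u i) ∧ ∀ j, H.Adj (u i) (c j) ↔ j = i + 1 ∨ j = i + 4) ∧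
      ∀ x, H.Adj o x → ∃ i ∈ I, x = u i := by
    let Q (i : Fin 5) (x : W) : Prop := H.Adj o x ∧ ∀ j, H.Adj x (c j) ↔ j = i + 1 ∨ j = i + 4
    refine ⟨Finset.univ.filter fun i => ∃ x, Q i x, fun i => Classical.epsilon (Q i),
      fun i hi => ?_, fun x hx => ?_⟩
    · exact Classical.epsilon_spec (Finset.mem_filter.1 hi).2
    · obtain ⟨i, hi⟩ := exists_type_of_five_cycle hT hF hc ho hx
      have hi' : ∃ x, Q i x := ⟨x, hx, hi⟩
      have h := Classical.epsilon_spec hi'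
      exact ⟨i, Finset.mem_filter.2 ⟨Finset.mem_univ _, hi'⟩, eq_of_type_eq hF hc ho hx h.1 hi h.2⟩
  obtain ⟨I, u, hu, hN⟩ := hex
  have hinj : Set.InjOn u I := by
    intro i hi j hj hij
    have h : ∀ k, (k = i + 1 ∨ k = i + 4) ↔ (k = j + 1 ∨ k = j + 4) := fun k => by
      rw [← (hu i hi).2, ← (hu j hj).2, hij]
    clear * - h
    revert h
    revert i j
    decide
  have hcinj : ∀ j, c (j + 1) ≠ c (j + 4) := by
    intro j hj
    have h : ∀ k, (k = (j + 1) + 1 ∨ k = (j + 1) + 4) ↔ (k = (j + 4) + 1 ∨ k = (j + 4) + 4) :=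
      fun k => by rw [← hcc, ← hcc, hj]
    clear * - h
    revert h
    revert j
    decide
  have hcardN : (N o).card ≤ I.card := by
    refine (Finset.card_le_card fun x hx => ?_).trans (Finset.card_image_le (f := u))
    obtain ⟨i, hi, rfl⟩ := hN x (memN.1 hx)
    exact Finset.mem_image_of_mem u hi
  let S (j : Fin 5) : Finset W :=
    (I.filter fun i => j = i + 1 ∨ j = i + 4).image u ∪ {c (j + 1), c (j + 4)}
  have hS : ∀ j, S j ⊆ N (c j) := by
    intro j x hx
    simp only [S, Finset.mem_union, Finset.mem_image, Finset.mem_filter, Finset.mem_insert,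
      Finset.mem_singleton] at hx
    rw [memN]
    rcases hx with ⟨i, ⟨hi, hij⟩, rfl⟩ | rfl | rfl
    · exact (((hu i hi).2 j).2 hij).symm
    · exact (hcc _ _).2 (Or.inl rfl)
    · exact (hcc _ _).2 (Or.inr rfl)
  have hScard : ∀ j, (S j).card = (I.filter fun i => j = i + 1 ∨ j = i + 4).card + 2 := by
    intro j
    rw [Finset.card_union_of_disjoint, Finset.card_pair (hcinj j), Finset.card_image_of_injOn]
    · exact hinj.mono fun i hi => (Finset.mem_filter.1 hi).1
    · rw [Finset.disjoint_left]
      intro x hx hx'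
      obtain ⟨i, hi, rfl⟩ := Finset.mem_image.1 hx
      have h := (hu i (Finset.mem_filter.1 hi).1).1
      simp only [Finset.mem_insert, Finset.mem_singleton] at hx'
      rcases hx' with e | e <;> exact ho _ (e ▸ h)
  have hdeg : ∀ j, (I.filter fun i => j = i + 1 ∨ j = i + 4).card + 2 ≤ I.card := fun j =>
    (hScard j).symm.le.trans ((Finset.card_le_card (hS j)).trans
      ((hmax _ (Finset.mem_univ _)).trans hcardN))
  have key : ∀ I : Finset (Fin 5),
      (∀ j : Fin 5, (I.filter fun i => j = i + 1 ∨ j = i + 4).card + 2 ≤ I.card) →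
      I = Finset.univ ∨ ∃ k, ∀ i, i ∈ I ↔ i ≠ k := by decide
  rcases key I hdeg with rfl | ⟨k, hk⟩
  · exact Or.inl (exists_grotzsch hT hcc ho (fun i => (hu i (Finset.mem_univ _)).1)
      fun i => (hu i (Finset.mem_univ _)).2)
  have hSeq : ∀ j, j ≠ k + 1 → j ≠ k + 4 → N (c j) = S j := by
    intro j h1 h4
    refine (Finset.eq_of_subset_of_card_le (hS j) ?_).symm
    refine ((hmax _ (Finset.mem_univ _)).trans hcardN).trans ?_
    rw [hScard]
    have key : ∀ (I : Finset (Fin 5)) (j k : Fin 5), j ≠ k + 1 → j ≠ k + 4 → (∀ i, i ∈ I ↔ i ≠ k) →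
      I.card ≤ (I.filter fun i => j = i + 1 ∨ j = i + 4).card + 2 := by decide
    exact key I j k h1 h4 hk
  have hmemI : ∀ i, i ≠ 0 → i + k ∈ I := fun i hi => (hk _).2 (by simpa using hi)
  refine Or.inr (FourSpokes.exists_clebschMinusSquare (c := fun i => c (i + k))
    (u := fun i => u (i + k)) (o := o) ⟨fun i j => ?_, fun i => ho _,
      fun i hi => (hu _ (hmemI i hi)).1, fun i hi j => ?_, fun x hx => ?_, fun j h1 h4 x hx => ?_⟩
      hT hF hcol)
  · rw [hcc]
    clear * -
    decide +revert
  · rw [(hu _ (hmemI i hi)).2]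
    clear * -
    decide +revert
  · obtain ⟨i, hi, rfl⟩ := hN x hx
    refine ⟨i - k, sub_ne_zero.2 ((hk i).1 hi), by rw [sub_add_cancel]⟩
  · have h := hSeq (j + k) (fun e => h1 (by clear * - e; decide +revert))
      (fun e => h4 (by clear * - e; decide +revert))
    rw [← memN, h] at hx
    simp only [S, Finset.mem_union, Finset.mem_image, Finset.mem_filter, Finset.mem_insert,
      Finset.mem_singleton] at hx
    rw [add_right_comm j 1 k, add_right_comm j 4 k]
    rcases hx with ⟨i, ⟨hi, hij⟩, rfl⟩ | rfl | rfl
    · have : i = j + k + 1 ∨ i = j + k + 4 := by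
        clear * - hij
        decide +revert
      rcases this with rfl | rfl <;> simp
    · simp
    · simp

end NeighborhoodDichotomy

def grotzschClasses : List (List ℕ) := [
    [0, 109, 186, 191, 200, 237, 250, 309, 319, 381, 383, 400, 437, 442, 447, 509, 699, 703, 763,
    769, 811, 893, 969, 985, 1003, 1005, 1019, 1021, 1405, 1500, 1525, 2013],
    [63, 127, 255, 511, 575, 623, 639, 747, 751, 767, 831, 877, 879, 895, 959, 1007, 1023, 1087,
    1133, 1151, 1214, 1215, 1278, 1279, 1335, 1343, 1397, 1399, 1407, 1462, 1463, 1470, 1471,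
    1526, 1527, 1533, 1534, 1535, 1579, 1599, 1647, 1663, 1722, 1723, 1726, 1727, 1771, 1775,
    1786, 1787, 1790, 1791, 1847, 1855, 1901, 1903, 1909, 1911, 1917, 1919, 1974, 1975, 1978,
    1979, 1982, 1983, 1995, 1997, 1999, 2005, 2007, 2010, 2011, 2014, 2015, 2027, 2029, 2031,
    2037, 2038, 2039, 2042, 2043, 2045, 2046, 2047],
  [1078, 1092, 1142, 1492, 1538, 1590, 1738, 1742, 1861, 1863, 1938, 2006]]
def grotzschClasses₁ : List (List ℕ) := [
    [250, 623, 639, 699, 879, 895, 1019, 1023, 1214, 1278, 1500, 1599, 1738, 1855, 1901, 1911,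
    1917, 1919, 1978, 1979, 1982, 1983, 1995, 2006, 2007, 2013, 2038, 2039, 2045, 2047],
    [0, 309, 400, 437, 555, 703, 769, 811, 821, 831, 893, 959, 969, 985, 1021, 1861, 1938, 1939,
    1975, 2037],
  [575, 877, 955, 1005, 1590, 1847, 1909, 1974, 2005]]
def grotzschClasses₂ : List (List ℕ) := [
    [0, 309, 400, 437, 555, 769, 811, 821, 831, 969, 985, 1463, 1538, 1723, 1861, 1938, 1939,
    1975, 1979, 2007, 2011],
    [109, 250, 447, 877, 959, 1003, 1019, 1142, 1214, 1215, 1278, 1471, 1500, 1525, 1527, 1579,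
    1599, 1727, 1742, 1771, 1787, 1855, 1909, 1911, 1983, 1999, 2013, 2015, 2027, 2037, 2039,
    2043, 2047],
  [699, 955, 1335, 1847, 1863, 1995, 1997, 2005]]
def grotzschClasses₃ : List (List ℕ) := [
  [0, 109, 186, 751, 763, 769, 969, 1492, 1500, 1538, 1738],
    [309, 555, 575, 639, 703, 767, 811, 821, 831, 879, 895, 959, 1007, 1023, 1078, 1579, 1590,
    1599, 1663, 1723, 1727, 1787, 1791, 1847, 1855, 1861, 1863, 1903, 1911, 1919, 1938, 1939,
    1975, 1979, 1983, 2027, 2031, 2043, 2047],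
    [63, 127, 191, 319, 509, 623, 699, 747, 877, 893, 955, 1003, 1005, 1019, 1087, 1278, 1397,
    1405, 1462, 1470, 1525, 1526, 1533, 1534, 1647, 1722, 1726, 1771, 1775, 1786, 1901, 1978,
    1995, 1997, 1999, 2005, 2006, 2010, 2011, 2013, 2014]]
def grotzschClasses₄ : List (List ℕ) := [
  [0, 109, 400, 769, 1078, 1092, 1133, 1142, 1492, 1738, 1742, 1861],
    [186, 309, 319, 437, 442, 447, 511, 555, 699, 703, 763, 811, 821, 831, 893, 895, 955, 959,
    969, 985, 1003, 1007, 1019, 1021, 1023, 1463, 1471, 1723, 1855, 1938, 1939, 1975, 1978, 1979,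
    1982, 1983, 2011, 2015, 2027, 2037, 2039, 2042, 2043, 2045, 2047],
    [63, 191, 509, 575, 747, 877, 879, 1005, 1462, 1470, 1722, 1847, 1974, 1995, 2005, 2007, 2010,
    2013]]
def clebschClasses : List (List ℕ) := [
    [0, 50, 385, 978, 979, 1010, 1096, 1146, 1205, 1207, 1461, 1481, 1748, 1756, 1781, 1783, 2006,
    2007, 2037, 2038, 2564, 3796],
    [1277, 1279, 1531, 1533, 1535, 1782, 1789, 1790, 1791, 2005, 2010, 2011, 2013, 2014, 2015,
    2039, 2042, 2043, 2045, 2046, 2047, 2863, 2879, 2927, 2938, 2939, 2942, 2943, 2991, 2999,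
    3007, 3019, 3023, 3030, 3031, 3034, 3035, 3038, 3039, 3051, 3055, 3062, 3063, 3066, 3067,
    3070, 3071, 3135, 3199, 3261, 3263, 3325, 3327, 3391, 3435, 3439, 3451, 3455, 3501, 3503,
    3517, 3519, 3563, 3565, 3567, 3579, 3581, 3583, 3647, 3710, 3711, 3765, 3767, 3773, 3775,
    3829, 3830, 3831, 3837, 3838, 3839, 3887, 3903, 3947, 3951, 3962, 3963, 3966, 3967, 4013,
    4015, 4021, 4023, 4029, 4031, 4043, 4045, 4047, 4053, 4054, 4055, 4058, 4059, 4061, 4062,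
    4063, 4075, 4077, 4079, 4085, 4086, 4087, 4090, 4091, 4093, 4094, 4095],
  [2347, 2363, 2475, 2614, 2890, 2894, 2923, 2949, 3117, 3181, 3375, 3629, 3914]]

theorem clebsch_partitionOK :
    partitionOK clebschMinusSquare (fun _ => true) clebschClasses = true := by
  decide +kernel

theorem grotzsch_partitionOK :
    partitionOK grotzsch (fun t => !branchTraces.elem t) grotzschClasses = true := by
  decide +kernel

theorem grotzsch_partitionOK₁ :
    partitionOK grotzsch (fun t => !separated grotzsch 821 t ||
      nonadjOK grotzsch 821 t && nonadjOK grotzsch t 821)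
      grotzschClasses₁ = true := by
  decide +kernel

theorem grotzsch_partitionOK₂ :
    partitionOK grotzsch (fun t => !separated grotzsch 1939 t ||
      nonadjOK grotzsch 1939 t && nonadjOK grotzsch t 1939)
      grotzschClasses₂ = true := by
  decide +kernel

theorem grotzsch_partitionOK₃ :
    partitionOK grotzsch (fun t => !separated grotzsch 555 t ||
      nonadjOK grotzsch 555 t && nonadjOK grotzsch t 555)
      grotzschClasses₃ = true := by
  decide +kernel

theorem grotzsch_partitionOK₄ :
    partitionOK grotzsch (fun t => !separated grotzsch 955 t ||
      nonadjOK grotzsch 955 t && nonadjOK grotzsch t 955)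
      grotzschClasses₄ = true := by
  decide +kernel

section Main

variable {V : Type*} {G : SimpleGraph V}

theorem ColorableOn.image_val {s : Set V} {T : Set s} {k : ℕ} (h : ColorableOn (G.induce s) T k) :
    ColorableOn G (Subtype.val '' T) k := by
  classical
  obtain ⟨f, h1, h2⟩ := h
  refine ⟨fun x => if hx : x ∈ s then f ⟨x, hx⟩ else 0, ?_, ?_⟩
  · rintro _ ⟨⟨x, hx⟩, hxT, rfl⟩
    simpa [hx] using h1 _ hxT
  · rintro _ ⟨⟨x, hx⟩, hxT, rfl⟩ _ ⟨⟨y, hy⟩, hyT, rfl⟩ hxy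
    simpa [hx, hy] using h2 _ hxT _ hyT hxy

theorem exists_isCopyInNeighbors {a : V} {K : List ℕ} {n : ℕ} (hn : K.length = n)
    (hrow : ∀ i < n, K.getD i 0 < 2 ^ n)
    (hdist : ∀ i < n, ∀ j < n, K.getD i 0 = K.getD j 0 → i = j)
    {ψ : Fin n → {x | G.Adj a x}}
    (hψ : ∀ i j, (G.induce {x | G.Adj a x}).Adj (ψ i) (ψ j) ↔ (K.getD i 0).testBit j = true) :
    ∃ φ, IsCopyInNeighbors G a K φ := by
  subst hn
  let φ (i : ℕ) : V := if h : i < K.length then ψ ⟨i, h⟩ else a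
  have hφ : ∀ i (h : i < K.length), φ i = ψ ⟨i, h⟩ := fun i h => dif_pos h
  have hadj : ∀ i < K.length, ∀ j < K.length,
      G.Adj (φ i) (φ j) ↔ (K.getD i 0).testBit j = true := fun i hi j hj => by
    rw [hφ i hi, hφ j hj]
    exact hψ _ _
  refine ⟨φ, hrow, fun i hi => hφ i hi ▸ (ψ ⟨i, hi⟩).2, hadj, fun i hi j hj hij => ?_⟩
  refine hdist i hi j hj (Nat.eq_of_testBit_eq fun k => ?_)
  by_cases hk : k < K.length
  · rw [Bool.eq_iff_iff, ← hadj i hi k hk, ← hadj j hj k hk, hij]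
  · have h2 : 2 ^ K.length ≤ 2 ^ k := Nat.pow_le_pow_right two_pos (not_lt.1 hk)
    rw [Nat.testBit_lt_two_pow ((hrow i hi).trans_le h2),
      Nat.testBit_lt_two_pow ((hrow j hj).trans_le h2)]

theorem colorableOn_three_of_grotzsch (hF : MatchingNonneighbors G) (hK : TetrahedronFree G)
    {a : V} {φ : ℕ → V} (hC : IsCopyInNeighbors G a grotzsch φ) :
    ColorableOn G {x | ¬ G.Adj a x} 3 := by
  by_cases h : ∃ p, ¬ G.Adj a p ∧ trace G φ grotzsch.length p ∈ branchTraces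
  · obtain ⟨p, hp, ht⟩ := h
    have key : ∀ d, trace G φ grotzsch.length p = d → ∀ q, ¬ G.Adj a q →
        (!separated grotzsch d (trace G φ grotzsch.length q) ||
          nonadjOK grotzsch d (trace G φ grotzsch.length q) &&
            nonadjOK grotzsch (trace G φ grotzsch.length q) d) = true := by
      rintro d rfl q hq
      simp only [Bool.or_eq_true, Bool.and_eq_true, Bool.not_eq_true', Bool.eq_false_iff, ne_eq]
      by_cases hpq : G.Adj p q
      · exact Or.inl fun h => hC.separated_trace hF hK hp hq h hpq
      · exact Or.inr ⟨hC.nonadjOK_trace hF hpq, hC.nonadjOK_trace hF fun h => hpq h.symm⟩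
    simp only [branchTraces, List.mem_cons, List.not_mem_nil, or_false] at ht
    rcases ht with ht | ht | ht | ht
    · exact hC.colorableOn hF hK grotzsch_partitionOK₁ (key _ ht)
    · exact hC.colorableOn hF hK grotzsch_partitionOK₂ (key _ ht)
    · exact hC.colorableOn hF hK grotzsch_partitionOK₃ (key _ ht)
    · exact hC.colorableOn hF hK grotzsch_partitionOK₄ (key _ ht)
  · push Not at h
    exact hC.colorableOn hF hK grotzsch_partitionOK fun p hp => by simpa using h p hp

theorem colorableOn_three_of_not_colorableOn_two [Fintype V]
    (hF : MatchingNonneighbors G) (hK : TetrahedronFree G) {a b : V} (hab : G.Adj a b)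
    (ha : ∀ v, G.Adj a v → ¬ ColorableOn G {x | G.Adj a x ∧ ¬ G.Adj v x} 2) :
    ColorableOn G {x | ¬ G.Adj a x} 3 := by
  let H := G.induce {x | G.Adj a x}
  have : Nonempty {x | G.Adj a x} := ⟨⟨b, hab⟩⟩
  have hT : TriangleFree H := fun x y z hxy hyz hxz => hK x.2 y.2 z.2 hxy hxz hyz
  have hF' : MatchingNonneighbors H := fun x y z w v h1 h2 h3 h4 h5 h6 h7 h8 h9 h10 =>
    hF h1 h2 (fun h => h3 (Subtype.ext h)) h4 h5 h6 h7 h8 h9 h10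
  have hcol : ∀ v, ¬ ColorableOn H {x | ¬ H.Adj v x} 2 := fun v h =>
    ha v v.2 (h.image_val.mono (fun x hx => ⟨⟨x, hx.1⟩, hx.2, rfl⟩) le_rfl)
  rcases exists_grotzsch_or_clebschMinusSquare hT hF' hcol with ⟨ψ, hψ⟩ | ⟨ψ, hψ⟩
  · obtain ⟨φ, hC⟩ := exists_isCopyInNeighbors (K := grotzsch) rfl (by decide)
      (by decide) hψ
    exact colorableOn_three_of_grotzsch hF hK hC
  · obtain ⟨φ, hC⟩ := exists_isCopyInNeighbors (K := clebschMinusSquare) rfl (by decide)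
      (by decide) hψ
    exact hC.colorableOn hF hK clebsch_partitionOK fun _ _ => rfl

theorem colorableOn_neighbors_inter (hK : TetrahedronFree G) {v w : V} (hvw : G.Adj v w) :
    ColorableOn G {x | G.Adj v x ∧ G.Adj w x} 1 :=
  colorableOn_one fun _ hx _ hy hxy => hK hvw hx.1 hy.1 hx.2 hy.2 hxy

theorem colorableOn_neighbors [Fintype V] (hF : MatchingNonneighbors G)
    (hK : TetrahedronFree G) (a : V) :
    ColorableOn G {x | G.Adj a x} 4 := by
  by_cases h : ∃ x y, G.Adj a x ∧ G.Adj a y ∧ G.Adj x y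
  · obtain ⟨x, y, hx, hy, hxy⟩ := h
    have h2 : ColorableOn G {z | ¬ G.Adj x z ∧ ¬ G.Adj y z} 2 :=
      hF.colorableOn_two hxy fun z hz => hz
    refine (((colorableOn_neighbors_inter hK hx).union
      (colorableOn_neighbors_inter hK hy)).union h2).mono (fun z hz => ?_) le_rfl
    simp only [Set.mem_union, Set.mem_ofPred_eq] at hz ⊢
    tauto
  · push Not at h
    exact (colorableOn_one fun x hx y hy => h x y hx hy).mono subset_rfl (by norm_num)

theorem MatchingNonneighbors.colorableOn_univ [Fintype V] (hF : MatchingNonneighbors G)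
    (hK : TetrahedronFree G) : ColorableOn G Set.univ 7 := by
  by_cases h : ∃ a b, G.Adj a b ∧
      ∀ v, G.Adj a v → ¬ ColorableOn G {x | G.Adj a x ∧ ¬ G.Adj v x} 2
  · obtain ⟨a, b, hab, ha⟩ := h
    exact ((colorableOn_neighbors hF hK a).union
      (colorableOn_three_of_not_colorableOn_two hF hK hab ha)).mono (fun x _ => em _) le_rfl
  push Not at h
  have hN : ∀ a b, G.Adj a b → ColorableOn G {x | G.Adj a x} 3 := by
    intro a b hab
    obtain ⟨v, hv, hv2⟩ := h a b hab
    refine ((colorableOn_neighbors_inter hK hv).union hv2).mono (fun x hx => ?_) le_rfl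
    simp only [Set.mem_union, Set.mem_ofPred_eq] at hx ⊢
    tauto
  by_cases hE : ∃ w v, G.Adj w v
  · obtain ⟨w, b, hwb⟩ := hE
    obtain ⟨v, hv, hv2⟩ := h w b hwb
    have h2 : ColorableOn G {z | ¬ G.Adj w z ∧ ¬ G.Adj v z} 2 :=
      hF.colorableOn_two hv fun z hz => hz
    refine (((hN v w hv.symm).union hv2).union h2).mono (fun x _ => ?_) le_rfl
    simp only [Set.mem_union, Set.mem_ofPred_eq]
    tauto
  · push Not at hE
    exact (colorableOn_one fun x _ y _ => hE x y).mono subset_rfl (by norm_num)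

end Main

theorem chromatic_le_seven {V : Type*} [Fintype V] (G : SimpleGraph V)
    (hP : ¬ Contains G P3P2) (hK : ¬ Contains G (completeGraph (Fin 4))) :
    G.chromaticNumber ≤ 7 := by
  have hK := tetrahedronFree_of_not_contains hK
  have h := (pathEdgeFree_of_not_contains hP).matchingNonneighbors_or_colorableOn hK
  exact (h.elim (fun hF => hF.colorableOn_univ hK) id).colorable.chromaticNumber_le
end

section
/- Let G be a (P₃∪P₂, K₄)-free graph. If G contains co-domino or G contains co-A, then χ(G) ≤ 7. -/
open SimpleGraph

namespace TraceColoring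

/-- A configuration of already chosen vertices: pairs `(i, r)`, where bit `j` of `r` says whether
the vertices numbered `i` and `j` are adjacent. -/
abbrev Rows := List (ℕ × ℕ)

/-- `x.testBit i`, in a form that the kernel evaluates quickly. -/
def hasBit (x i : ℕ) : Bool :=
  Nat.beq (Nat.land (Nat.shiftRight x i) 1) 1

theorem hasBit_eq (x i : ℕ) : hasBit x i = x.testBit i := by
  have : Nat.land (Nat.shiftRight x i) 1 = x / 2 ^ i % 2 := by
    rw [← Nat.shiftRight_eq_div_pow]
    exact Nat.and_one_is_mod _
  rw [Bool.eq_iff_iff, hasBit, Nat.beq_eq, this, Nat.testBit_eq_decide_div_mod_eq,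
    decide_eq_true_iff]

/-- The chosen vertices adjacent to none of three vertices with traces `x`, `y` and `z`. -/
def far (rows : Rows) (x y z : ℕ) : Rows :=
  rows.filter fun p => !hasBit x p.1 && !hasBit y p.1 && !hasBit z p.1

/-- Two of the listed vertices are adjacent. -/
def hasEdge (l : Rows) : Bool :=
  l.any fun p => l.any fun q => hasBit p.2 q.1

/-- Some induced `P₃` of the chosen vertices lies in the list `l`. -/
def hasP3 (l : Rows) : Bool :=
  l.any fun p => l.any fun q => hasBit p.2 q.1 &&
    l.any fun r => hasBit p.2 r.1 && (q.1 != r.1 && !hasBit q.2 r.1)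

/-- Adjacent vertices with traces `x` and `y` create a `K₄` or an induced `P₃ ∪ P₂`. -/
def clashAdj (rows : Rows) (x y : ℕ) : Bool :=
  hasEdge (rows.filter fun p => hasBit x p.1 && hasBit y p.1) ||
  hasP3 (far rows x y 0) ||
  rows.any fun z => (hasBit x z.1 != hasBit y z.1) && hasEdge (far rows x y z.2)

/-- Distinct nonadjacent vertices with traces `x` and `y` create an induced `P₃ ∪ P₂` in which
the first one lies in `P₂` and the second one in `P₃`. -/
def clashCross (rows : Rows) (x y : ℕ) : Bool :=
  rows.any fun p => hasBit x p.1 && !hasBit y p.1 &&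
    (far rows x p.2 0).any fun q => hasBit y q.1 &&
      (far rows x p.2 0).any fun r => q.1 != r.1 &&
        (hasBit y r.1 && !hasBit q.2 r.1 || !hasBit y r.1 && hasBit q.2 r.1)

/-- Distinct nonadjacent vertices with traces `x` and `y` create an induced `P₃ ∪ P₂`. -/
def clashNon (rows : Rows) (x y : ℕ) : Bool :=
  (rows.any fun z => hasBit x z.1 && hasBit y z.1 && hasEdge (far rows x y z.2)) ||
  clashCross rows x y || clashCross rows y x

/-- What is known about a graph: the chosen vertices, the possible traces of the other vertices,
and pairs `(s, v)` such that no two adjacent vertices have traces `t`, `t'` with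
`t >>> s = t' >>> s = v`. -/
structure State where
  rows : Rows
  traces : List ℕ
  indep : List (ℕ × ℕ)

/-- Choose a further vertex with trace `t`; it gets number `0`. -/
def State.extend (S : State) (t : ℕ) : State where
  rows := (0, Nat.bit false t) :: S.rows.map fun p => (p.1 + 1, Nat.bit (hasBit t p.1) p.2)
  traces := S.traces.flatMap fun x =>
    (if clashNon S.rows t x then [] else [Nat.bit false x]) ++
    (if clashAdj S.rows t x then [] else [Nat.bit true x])
  indep := S.indep.map fun p => (p.1 + 1, p.2)

/-- Attach the base-`m` digits of `c` to the entries of a list. -/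
def attachDigits {α : Type*} (m : ℕ) : ℕ → List α → List (α × ℕ)
  | _, [] => []
  | c, a :: l => (a, c % m) :: attachDigits m (c / m) l

/-- The vertices with trace `t` induce a graph of maximum degree at most one. -/
def matchingClass (rows : Rows) (t : ℕ) : Bool :=
  (rows.any fun p => hasBit t p.1) && hasEdge (far rows t 0 0)

/-- The given colors of chosen vertices and of traces always yield a proper coloring. A trace with
label `k` may use the two colors `k % 7` and `k / 7`. -/
def State.proper (S : State) (B : List ((ℕ × ℕ) × ℕ)) (C : List (ℕ × ℕ)) : Bool :=
  (B.all fun p => B.all fun q => !hasBit p.1.2 q.1.1 || p.2 != q.2) &&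
  (C.all fun u => B.all fun p => !hasBit u.1 p.1.1 || (u.2 % 7 != p.2 && u.2 / 7 != p.2)) &&
  (C.all fun u => C.all fun v =>
    (u.2 % 7 != v.2 % 7 && u.2 % 7 != v.2 / 7 && u.2 / 7 != v.2 % 7 && u.2 / 7 != v.2 / 7) ||
    clashAdj S.rows u.1 v.1 ||
    (S.indep.any fun p => u.1 >>> p.1 == p.2 && v.1 >>> p.1 == p.2) ||
    (u == v && u.2 % 7 != u.2 / 7 && matchingClass S.rows u.1))

/-- A case distinction ending in explicit 7-colorings. -/
inductive Cases
  /-- Color chosen vertices by base-7 digits and label traces by base-49 digits. -/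
  | leaf (b c : ℕ)
  /-- Some vertex has trace `t`, or none has. -/
  | vertex (t : ℕ) (yes no : Cases)
  /-- Some two adjacent vertices have trace `t`, or no two have. -/
  | edge (t : ℕ) (yes no : Cases)

/-- The case distinction proves 7-colorability of all graphs described by the state. -/
def Cases.check : Cases → State → Bool
  | .leaf b c, S => S.proper (attachDigits 7 b S.rows) (attachDigits 49 c S.traces)
  | .vertex t yes no, S => yes.check (S.extend t) &&
      no.check { S with traces := S.traces.filter (· != t) }
  | .edge t yes no, S => yes.check ((S.extend t).extend (Nat.bit true t)) &&
      no.check { S with indep := (0, t) :: S.indep }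

variable {V : Type*} {G : SimpleGraph V}

/-- The neighbors of `y` among the chosen vertices are recorded by `t`. -/
def IsTrace (G : SimpleGraph V) (rows : Rows) (f : ℕ → V) (y : V) (t : ℕ) : Prop :=
  ∀ p ∈ rows, t.testBit p.1 = true ↔ G.Adj y (f p.1)

/-- The vertex `y` is not a chosen one. -/
def Outside (rows : Rows) (f : ℕ → V) (y : V) : Prop :=
  ∀ p ∈ rows, f p.1 ≠ y

/-- The state `S` correctly describes `G`, where the vertex numbered `i` is `f i`. -/
structure Describes (G : SimpleGraph V) (S : State) (f : ℕ → V) : Prop where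
  row : ∀ p ∈ S.rows, IsTrace G S.rows f (f p.1) p.2
  inj : ∀ p ∈ S.rows, ∀ q ∈ S.rows, f p.1 = f q.1 → p.1 = q.1
  trace : ∀ y, Outside S.rows f y → ∃ t ∈ S.traces, IsTrace G S.rows f y t
  indep : ∀ p ∈ S.indep, ∀ x y t u, Outside S.rows f x → Outside S.rows f y →
    IsTrace G S.rows f x t → IsTrace G S.rows f y u → t >>> p.1 = p.2 → u >>> p.1 = p.2 →
    ¬ G.Adj x y

/-- The pattern form of being `(P₃ ∪ P₂, K₄)`-free. -/
structure PatternFree (G : SimpleGraph V) : Prop where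
  k4 : ∀ a b c d, G.Adj a b → G.Adj a c → G.Adj a d → G.Adj b c → G.Adj b d → ¬ G.Adj c d
  p3p2 : ∀ a b c d e, G.Adj a b → G.Adj b c → a ≠ c → ¬ G.Adj a c → G.Adj d e →
    ¬ G.Adj a d → ¬ G.Adj a e → ¬ G.Adj b d → ¬ G.Adj b e → ¬ G.Adj c d → ¬ G.Adj c e → False

theorem contains_of_lt {n : ℕ} {H : SimpleGraph (Fin n)} (f : Fin n → V)
    (hf : ∀ i j, i < j → f i ≠ f j ∧ (G.Adj (f i) (f j) ↔ H.Adj i j)) : Contains G H := by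
  refine ⟨⟨⟨f, fun i j he => ?_⟩, fun {i j} => ?_⟩⟩
  · obtain h | h | h := lt_trichotomy i j
    · exact absurd he (hf i j h).1
    · exact h
    · exact absurd he.symm (hf j i h).1
  · obtain h | rfl | h := lt_trichotomy i j
    · exact (hf i j h).2
    · simp
    · rw [G.adj_comm, H.adj_comm]
      exact (hf j i h).2

theorem PatternFree.of_not_contains (hP : ¬ Contains G P3P2)
    (hK : ¬ Contains G (completeGraph (Fin 4))) : PatternFree G where
  k4 a b c d hab hac had hbc hbd hcd := by
    refine hK (contains_of_lt ![a, b, c, d] ?_)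
    simp [Fin.forall_fin_succ, hab, hac, had, hbc, hbd, hcd, hab.ne, hac.ne, had.ne,
      hbc.ne, hbd.ne, hcd.ne]
  p3p2 a b c d e hab hbc hac nac hde had hae hbd hbe hcd hce := by
    refine hP (contains_of_lt ![a, b, c, d, e] ?_)
    have ne {x y z : V} (hxy : G.Adj x y) (hzy : ¬ G.Adj z y) : z ≠ x := by
      rintro rfl
      exact hzy hxy
    simp [Fin.forall_fin_succ, P3P2, hab, hbc, hac, nac, hde, had, hae, hbd, hbe, hcd,
      hce, hab.ne, hbc.ne, hde.ne, ne hde hae, ne hde hbe, ne hde hce, ne hde.symm had,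
      ne hde.symm hbd, ne hde.symm hcd]

theorem mem_far {rows : Rows} {x y z : ℕ} {p : ℕ × ℕ} :
    p ∈ far rows x y z ↔ p ∈ rows ∧ x.testBit p.1 = false ∧ y.testBit p.1 = false ∧
      z.testBit p.1 = false := by
  simp [far, hasBit_eq, and_assoc]

section

variable {S : State} {f : ℕ → V} {x y : V} {t u : ℕ}

theorem IsTrace.adj (h : IsTrace G S.rows f x t) {p : ℕ × ℕ} (hp : p ∈ S.rows)
    (ht : t.testBit p.1 = true) : G.Adj x (f p.1) :=
  (h p hp).1 ht

theorem IsTrace.not_adj (h : IsTrace G S.rows f x t) {p : ℕ × ℕ} (hp : p ∈ S.rows)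
    (ht : t.testBit p.1 = false) : ¬ G.Adj x (f p.1) := fun ha => by
  simp [(h p hp).2 ha] at ht

theorem Describes.ne (h : Describes G S f) {p q : ℕ × ℕ} (hp : p ∈ S.rows) (hq : q ∈ S.rows)
    (hpq : p.1 ≠ q.1) : f p.1 ≠ f q.1 :=
  fun he => hpq (h.inj p hp q hq he)

theorem Describes.not_hasEdge_far (h : Describes G S f) (hG : PatternFree G) {z : ℕ × ℕ}
    (hz : z ∈ S.rows) (hx : IsTrace G S.rows f x t) (hy : IsTrace G S.rows f y u) {a b c : V}
    (hab : G.Adj a b) (hbc : G.Adj b c) (hac : a ≠ c) (nac : ¬ G.Adj a c)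
    (hs : ∀ w, ¬ G.Adj x w → ¬ G.Adj y w → ¬ G.Adj (f z.1) w →
      ¬ G.Adj a w ∧ ¬ G.Adj b w ∧ ¬ G.Adj c w) :
    hasEdge (far S.rows t u z.2) = false := by
  by_contra hcon
  simp only [hasEdge, hasBit_eq, Bool.not_eq_false, List.any_eq_true, mem_far] at hcon
  obtain ⟨p, ⟨hp, px, py, pz⟩, q, ⟨hq, qx, qy, qz⟩, hpq⟩ := hcon
  have hz' := h.row z hz
  obtain ⟨h1, h2, h3⟩ := hs _ (hx.not_adj hp px) (hy.not_adj hp py) (hz'.not_adj hp pz)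
  obtain ⟨h4, h5, h6⟩ := hs _ (hx.not_adj hq qx) (hy.not_adj hq qy) (hz'.not_adj hq qz)
  exact hG.p3p2 a b c _ _ hab hbc hac nac ((h.row p hp).adj hq hpq) h1 h4 h2 h5 h3 h6

theorem Describes.not_adj_of_clashAdj (h : Describes G S f) (hG : PatternFree G)
    (hx : IsTrace G S.rows f x t) (hy : IsTrace G S.rows f y u) (hxo : Outside S.rows f x)
    (hyo : Outside S.rows f y) (hc : clashAdj S.rows t u = true) : ¬ G.Adj x y := fun hxy => by
  simp only [clashAdj, hasBit_eq, Bool.or_eq_true] at hc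
  obtain (hc | hc) | hc := hc
  · simp only [hasEdge, hasBit_eq, List.any_eq_true, List.mem_filter, Bool.and_eq_true] at hc
    obtain ⟨p, ⟨hp, px, py⟩, q, ⟨hq, qx, qy⟩, hpq⟩ := hc
    exact hG.k4 x y _ _ hxy (hx.adj hp px) (hx.adj hq qx) (hy.adj hp py) (hy.adj hq qy)
      ((h.row p hp).adj hq hpq)
  · simp only [hasP3, hasBit_eq, List.any_eq_true, Bool.and_eq_true, mem_far, bne_iff_ne,
      Bool.not_eq_true'] at hc
    obtain ⟨p, ⟨hp, px, py, -⟩, q, ⟨hq, qx, qy, -⟩, hpq, r, ⟨hr, rx, ry, -⟩, hpr, hqr, nqr⟩ := hc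
    have swap {a b : V} (n : ¬ G.Adj a b) : ¬ G.Adj b a := fun e => n e.symm
    exact hG.p3p2 _ _ _ x y ((h.row p hp).adj hq hpq).symm ((h.row p hp).adj hr hpr)
      (h.ne hq hr hqr) ((h.row q hq).not_adj hr nqr) hxy (swap (hx.not_adj hq qx))
      (swap (hy.not_adj hq qy)) (swap (hx.not_adj hp px)) (swap (hy.not_adj hp py))
      (swap (hx.not_adj hr rx)) (swap (hy.not_adj hr ry))
  · simp only [List.any_eq_true, Bool.and_eq_true, bne_iff_ne] at hc
    obtain ⟨z, hz, hd, he⟩ := hc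
    cases zx : t.testBit z.1 <;> cases zy : u.testBit z.1 <;> simp only [zx, zy, ne_eq,
      not_true_eq_false] at hd
    · have := h.not_hasEdge_far hG hz hx hy hxy (hy.adj hz zy) (hxo z hz).symm (hx.not_adj hz zx)
        fun w h1 h2 h3 => ⟨h1, h2, h3⟩
      simp [this] at he
    · have := h.not_hasEdge_far hG hz hx hy hxy.symm (hx.adj hz zx) (hyo z hz).symm
        (hy.not_adj hz zy) fun w h1 h2 h3 => ⟨h2, h1, h3⟩
      simp [this] at he

theorem Describes.false_of_clashCross (h : Describes G S f) (hG : PatternFree G)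
    (hx : IsTrace G S.rows f x t) (hy : IsTrace G S.rows f y u)
    (nxy : ¬ G.Adj x y) (hyo : Outside S.rows f y)
    (hc : clashCross S.rows t u = true) : False := by
  simp only [clashCross, hasBit_eq, List.any_eq_true, Bool.and_eq_true, Bool.or_eq_true, mem_far,
    bne_iff_ne, Bool.not_eq_true'] at hc
  obtain ⟨p, hp, ⟨px, py⟩, q, ⟨hq, qx, qp, -⟩, qy, r, ⟨hr, rx, rp, -⟩, hqr, hc⟩ := hc
  have swap {a b : V} (n : ¬ G.Adj a b) : ¬ G.Adj b a := fun e => n e.symm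
  have hxp := hx.adj hp px
  have nyp := hy.not_adj hp py
  have nqx := swap (hx.not_adj hq qx)
  have nqp := swap ((h.row p hp).not_adj hq qp)
  have nrx := swap (hx.not_adj hr rx)
  have nrp := swap ((h.row p hp).not_adj hr rp)
  have hyq := hy.adj hq qy
  obtain ⟨ry, nqr⟩ | ⟨ry, nqr⟩ := hc
  · exact hG.p3p2 _ y _ x _ hyq.symm (hy.adj hr ry) (h.ne hq hr hqr) ((h.row q hq).not_adj hr nqr)
      hxp nqx nqp (swap nxy) nyp nrx nrp
  · exact hG.p3p2 y _ _ x _ hyq ((h.row q hq).adj hr nqr) (hyo r hr).symm (hy.not_adj hr ry)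
      hxp (swap nxy) nyp nqx nqp nrx nrp

theorem Describes.adj_of_clashNon (h : Describes G S f) (hG : PatternFree G)
    (hx : IsTrace G S.rows f x t) (hy : IsTrace G S.rows f y u) (hxo : Outside S.rows f x)
    (hyo : Outside S.rows f y) (hne : x ≠ y) (hc : clashNon S.rows t u = true) :
    G.Adj x y := by
  by_contra nxy
  simp only [clashNon, hasBit_eq, Bool.or_eq_true] at hc
  obtain (hc | hc) | hc := hc
  · simp only [List.any_eq_true, Bool.and_eq_true] at hc
    obtain ⟨z, hz, ⟨zx, zy⟩, he⟩ := hc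
    have := h.not_hasEdge_far hG hz hx hy (hx.adj hz zx) (hy.adj hz zy).symm hne nxy
      fun w h1 h2 h3 => ⟨h1, h3, h2⟩
    simp [this] at he
  · exact h.false_of_clashCross hG hx hy nxy hyo hc
  · exact h.false_of_clashCross hG hy hx (fun e => nxy e.symm) hxo hc

theorem Outside.of_extend {w : V}
    (hy : Outside (S.extend t).rows (fun i => Nat.casesOn i w f) y) : Outside S.rows f y :=
  fun p hp => hy (p.1 + 1, Nat.bit (hasBit t p.1) p.2)
    (List.mem_cons_of_mem _ (List.mem_map_of_mem hp))

theorem IsTrace.of_extend {w : V} {v : ℕ}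
    (hy : IsTrace G (S.extend t).rows (fun i => Nat.casesOn i w f) y v) :
    IsTrace G S.rows f y (v / 2) := by
  intro p hp
  have := hy (p.1 + 1, Nat.bit (hasBit t p.1) p.2)
    (List.mem_cons_of_mem _ (List.mem_map_of_mem hp))
  simp only [Nat.testBit_succ] at this
  exact this

theorem IsTrace.extend {w : V} {b : Bool} {v : ℕ} (hy : IsTrace G S.rows f y v)
    (hb : b = true ↔ G.Adj y w) :
    IsTrace G (S.extend t).rows (fun i => Nat.casesOn i w f) y (Nat.bit b v) := by
  intro p hp
  simp only [State.extend, hasBit_eq, List.mem_cons, List.mem_map] at hp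
  obtain rfl | ⟨q, hq, rfl⟩ := hp
  · simpa using hb
  · simpa only [Nat.testBit_bit_succ] using hy q hq

theorem Describes.extend (h : Describes G S f) (hG : PatternFree G)
    (hx : IsTrace G S.rows f x t) (hxo : Outside S.rows f x) :
    Describes G (S.extend t) (fun i => Nat.casesOn i x f) where
  row p hp := by
    simp only [State.extend, hasBit_eq, List.mem_cons, List.mem_map] at hp
    obtain rfl | ⟨q, hq, rfl⟩ := hp
    · exact IsTrace.extend (w := x) (b := false) hx (by simp)
    · exact (h.row q hq).extend (by rw [hx q hq, G.adj_comm])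
  inj p hp q hq := by
    simp only [State.extend, hasBit_eq, List.mem_cons, List.mem_map] at hp hq
    obtain rfl | ⟨p, hp, rfl⟩ := hp <;> obtain rfl | ⟨q, hq, rfl⟩ := hq
    · simp
    · exact fun he => absurd he.symm (hxo q hq)
    · exact fun he => absurd he (hxo p hp)
    · exact fun he => congrArg (· + 1) (h.inj p hp q hq he)
  trace y hy := by
    have hne : x ≠ y := hy (0, Nat.bit false t) List.mem_cons_self
    have hyo : Outside S.rows f y := Outside.of_extend hy
    obtain ⟨v, hv, hyv⟩ := h.trace y hyo
    by_cases hxy : G.Adj x y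
    · refine ⟨Nat.bit true v, List.mem_flatMap.2 ⟨v, hv, ?_⟩, hyv.extend (by simp [hxy.symm])⟩
      have : clashAdj S.rows t v = false := by
        by_contra hc
        exact h.not_adj_of_clashAdj hG hx hyv hxo hyo (by simpa using hc) hxy
      simp [this]
    · refine ⟨Nat.bit false v, List.mem_flatMap.2 ⟨v, hv, ?_⟩,
        hyv.extend (by simp [G.adj_comm y, hxy])⟩
      have : clashNon S.rows t v = false := by
        by_contra hc
        exact hxy (h.adj_of_clashNon hG hx hyv hxo hyo hne (by simpa using hc))
      simp [this]
  indep p hp := by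
    obtain ⟨q, hq, rfl⟩ := List.mem_map.1 hp
    intro y z v w hyo hzo hy hz hv hw
    refine h.indep q hq y z _ _ (Outside.of_extend hyo) (Outside.of_extend hzo)
      hy.of_extend hz.of_extend ?_ ?_
    · rwa [← Nat.shiftRight_one, ← Nat.shiftRight_add, Nat.add_comm]
    · rwa [← Nat.shiftRight_one, ← Nat.shiftRight_add, Nat.add_comm]

end

theorem exists_mem_attachDigits {α : Type*} {a : α} {m : ℕ} :
    ∀ {l : List α} (c : ℕ), a ∈ l → ∃ k, (a, k) ∈ attachDigits m c l
  | b :: l, c, h => by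
    obtain rfl | h := List.mem_cons.1 h
    · exact ⟨_, List.mem_cons_self⟩
    · obtain ⟨k, hk⟩ := exists_mem_attachDigits (c / m) h
      exact ⟨k, List.mem_cons_of_mem _ hk⟩

theorem of_mem_attachDigits {α : Type*} {a : α} {m k : ℕ} (hm : 0 < m) :
    ∀ {l : List α} {c : ℕ}, (a, k) ∈ attachDigits m c l → a ∈ l ∧ k < m
  | b :: l, c, h => by
    obtain h | h := List.mem_cons.1 h
    · obtain ⟨rfl, rfl⟩ := Prod.mk.injEq .. ▸ h
      exact ⟨List.mem_cons_self, Nat.mod_lt _ hm⟩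
    · exact ⟨List.mem_cons_of_mem _ (of_mem_attachDigits hm h).1, (of_mem_attachDigits hm h).2⟩

theorem Describes.eq_of_matchingClass {S : State} {f : ℕ → V} (h : Describes G S f)
    (hG : PatternFree G) {t : ℕ} {x y z : V} (hx : IsTrace G S.rows f x t)
    (hy : IsTrace G S.rows f y t) (hz : IsTrace G S.rows f z t) (hxy : G.Adj x y)
    (hxz : G.Adj x z) (hc : matchingClass S.rows t = true) : y = z := by
  simp only [matchingClass, hasBit_eq, hasEdge, Bool.and_eq_true, List.any_eq_true, mem_far] at hc
  obtain ⟨⟨p, hp, pt⟩, q, ⟨hq, qt, -⟩, r, ⟨hr, rt, -⟩, hqr⟩ := hc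
  by_contra hne
  by_cases hyz : G.Adj y z
  · exact hG.k4 x y z _ hxy hxz (hx.adj hp pt) hyz (hy.adj hp pt) (hz.adj hp pt)
  · exact hG.p3p2 y x z _ _ hxy.symm hxz hne hyz ((h.row q hq).adj hr hqr) (hy.not_adj hq qt)
      (hy.not_adj hr rt) (hx.not_adj hq qt) (hx.not_adj hr rt) (hz.not_adj hq qt)
      (hz.not_adj hr rt)

/-- In a graph of maximum degree at most one, the vertices with a smaller neighbor and the others
form independent sets. -/
theorem exists_lt_adj_iff_not [LinearOrder V] {P : V → Prop} {x y : V} (hx : P x) (hy : P y)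
    (hP : ∀ {a b c}, P a → P b → P c → G.Adj a b → G.Adj a c → b = c) (hxy : G.Adj x y) :
    (∃ z < x, G.Adj x z ∧ P z) ↔ ¬ ∃ z < y, G.Adj y z ∧ P z := by
  have hx' : (∃ z < x, G.Adj x z ∧ P z) ↔ y < x :=
    ⟨fun ⟨z, hz, hxz, pz⟩ => hP hx pz hy hxz hxy ▸ hz, fun hlt => ⟨y, hlt, hxy, hy⟩⟩
  have hy' : (∃ z < y, G.Adj y z ∧ P z) ↔ x < y :=
    ⟨fun ⟨z, hz, hyz, pz⟩ => hP hy pz hx hyz hxy.symm ▸ hz, fun hlt => ⟨x, hlt, hxy.symm, hx⟩⟩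
  rw [hx', hy', not_lt, hxy.ne'.le_iff_lt]

open Classical in
theorem Describes.colorable_of_proper {S : State} {f : ℕ → V} (h : Describes G S f)
    (hG : PatternFree G) {b c : ℕ}
    (hc : S.proper (attachDigits 7 b S.rows) (attachDigits 49 c S.traces) = true) :
    G.Colorable 7 := by
  let _ : LinearOrder V := linearOrderOfSTO WellOrderingRel
  set B := attachDigits 7 b S.rows
  set C := attachDigits 49 c S.traces
  have memB {p k} (hp : (p, k) ∈ B) : p ∈ S.rows ∧ k < 7 := of_mem_attachDigits (by norm_num) hp
  have memC {t k} (ht : (t, k) ∈ C) : k < 49 := (of_mem_attachDigits (by norm_num) ht).2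
  have hout : ∀ y, ∃ u : ℕ × ℕ, Outside S.rows f y → u ∈ C ∧ IsTrace G S.rows f y u.1 := by
    intro y
    by_cases hy : Outside S.rows f y
    · obtain ⟨t, ht, hyt⟩ := h.trace y hy
      obtain ⟨k, hk⟩ := exists_mem_attachDigits c ht
      exact ⟨(t, k), fun _ => ⟨hk, hyt⟩⟩
    · exact ⟨0, fun hy' => absurd hy' hy⟩
  choose lab hlab using hout
  let P (u : ℕ × ℕ) (y : V) : Prop := Outside S.rows f y ∧ lab y = u
  have hcol : ∀ y, ∃ k < 7, (∃ p, (p, k) ∈ B ∧ f p.1 = y) ∨ Outside S.rows f y ∧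
      k = if ∃ z < y, G.Adj y z ∧ P (lab y) z then (lab y).2 / 7 else (lab y).2 % 7 := by
    intro y
    by_cases hy : Outside S.rows f y
    · have := memC (hlab y hy).1
      refine ⟨_, ?_, .inr ⟨hy, rfl⟩⟩
      split_ifs <;> omega
    · simp only [Outside, not_forall, not_not] at hy
      obtain ⟨p, hp, rfl⟩ := hy
      obtain ⟨k, hk⟩ := exists_mem_attachDigits b hp
      exact ⟨k, (memB hk).2, .inl ⟨p, hk, rfl⟩⟩
  choose col hlt hcol using hcol
  simp only [State.proper, hasBit_eq, Bool.and_eq_true, List.all_eq_true, Bool.or_eq_true,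
    bne_iff_ne, Bool.not_eq_true', List.any_eq_true, beq_iff_eq] at hc
  obtain ⟨⟨hBB, hCB⟩, hCC⟩ := hc
  have mixed {x p k} {Q : Prop} (hp : (p, k) ∈ B) (hxo : Outside S.rows f x)
      (hxp : G.Adj x (f p.1)) : (if Q then (lab x).2 / 7 else (lab x).2 % 7) ≠ k := by
    obtain ⟨hx, hxt⟩ := hlab x hxo
    have hbit := (hxt p (memB hp).1).2 hxp
    obtain h1 | ⟨h1, h2⟩ := hCB _ hx _ hp
    · simp [hbit] at h1
    · split_ifs <;> assumption
  refine ⟨SimpleGraph.Coloring.mk (fun y => ⟨col y, hlt y⟩) fun {x y} hxy he => ?_⟩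
  have he : col x = col y := congrArg Fin.val he
  obtain ⟨p, hp, rfl⟩ | ⟨hxo, hx⟩ := hcol x <;> obtain ⟨q, hq, rfl⟩ | ⟨hyo, hy⟩ := hcol y
  · have hbit := (h.row p (memB hp).1 q (memB hq).1).2 hxy
    have := hBB _ hp _ hq
    simp [hbit, he] at this
  · exact mixed hp hyo hxy.symm (hy.symm.trans he.symm)
  · exact mixed hq hxo hxy (hx.symm.trans he)
  · obtain ⟨hxC, hxt⟩ := hlab x hxo
    obtain ⟨hyC, hyt⟩ := hlab y hyo
    rw [hx, hy] at he
    obtain ((⟨⟨⟨h1, h2⟩, h3⟩, h4⟩ | hcl) | ⟨p, hp, h1, h2⟩) | ⟨⟨heq, hne⟩, hm⟩ :=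
      hCC _ hxC _ hyC
    · split_ifs at he <;> contradiction
    · exact h.not_adj_of_clashAdj hG hxt hyt hxo hyo hcl hxy
    · exact h.indep p hp x y _ _ hxo hyo hxt hyt h1 h2 hxy
    · have tr {a} (ha : P (lab x) a) : IsTrace G S.rows f a (lab x).1 := ha.2 ▸ (hlab a ha.1).2
      have := exists_lt_adj_iff_not (P := P (lab x)) ⟨hxo, rfl⟩ ⟨hyo, heq.symm⟩
        (fun ha hb hc hab hac => h.eq_of_matchingClass hG (tr ha) (tr hb) (tr hc) hab hac hm) hxy
      rw [← heq] at he
      split_ifs at he with h1 h2 h2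
      · exact this.1 h1 h2
      · exact hne he.symm
      · exact hne he
      · exact h1 (this.2 h2)

theorem Describes.filter {S : State} {f : ℕ → V} (h : Describes G S f) {t : ℕ}
    (ht : ∀ y, Outside S.rows f y → ¬ IsTrace G S.rows f y t) :
    Describes G { S with traces := S.traces.filter (· != t) } f where
  row := h.row
  inj := h.inj
  trace y hy := by
    obtain ⟨u, hu, hyu⟩ := h.trace y hy
    refine ⟨u, List.mem_filter.2 ⟨hu, ?_⟩, hyu⟩
    have : u ≠ t := by rintro rfl; exact ht y hy hyu
    simpa using this
  indep := h.indep

theorem Describes.colorable_of_check {S : State} {f : ℕ → V} (hG : PatternFree G) :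
    ∀ {T : Cases}, Describes G S f → T.check S = true → G.Colorable 7 := by
  intro T
  induction T generalizing S f with
  | leaf b c => exact fun h hc => h.colorable_of_proper hG hc
  | vertex t yes no hyes hno =>
    intro h hc
    simp only [Cases.check, Bool.and_eq_true] at hc
    by_cases ht : ∃ y, Outside S.rows f y ∧ IsTrace G S.rows f y t
    · obtain ⟨y, hy, hyt⟩ := ht
      exact hyes (h.extend hG hyt hy) hc.1
    · push Not at ht
      exact hno (h.filter ht) hc.2
  | edge t yes no hyes hno =>
    intro h hc
    simp only [Cases.check, Bool.and_eq_true] at hc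
    by_cases ht : ∃ x y, Outside S.rows f x ∧ Outside S.rows f y ∧ IsTrace G S.rows f x t ∧
      IsTrace G S.rows f y t ∧ G.Adj x y
    · obtain ⟨x, y, hxo, hyo, hx, hy, hxy⟩ := ht
      refine hyes ((h.extend hG hx hxo).extend hG (hy.extend (by simp [hxy.symm])) ?_) hc.1
      intro p hp
      simp only [State.extend, hasBit_eq, List.mem_cons, List.mem_map] at hp
      obtain rfl | ⟨q, hq, rfl⟩ := hp
      · exact hxy.ne
      · exact hyo q hq
    · push Not at ht
      refine hno (S := { S with indep := (0, t) :: S.indep })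
        ⟨h.row, h.inj, h.trace, fun p hp => ?_⟩ hc.2
      obtain rfl | hp := List.mem_cons.1 hp
      · rintro x y u v hxo hyo hx hy (rfl : u = t) (rfl : v = u)
        exact ht x y hxo hyo hx hy
      · exact h.indep p hp

/-- Vertices `0, …, n - 1` have been chosen, where bit `k - 1 - i` of `l[k]` tells whether `i < k`
and `k` are adjacent. -/
def State.initial (l : List ℕ) : ℕ → State
  | 0 => ⟨[], [0], []⟩
  | k + 1 => (State.initial l k).extend (l.getD k 0)

theorem Describes.initial (hG : PatternFree G) {l : List ℕ} {g : ℕ → V} {n : ℕ}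
    (hg : ∀ k < n, ∀ i < k, g i ≠ g k ∧
      ((l.getD k 0).testBit (k - 1 - i) = true ↔ G.Adj (g k) (g i))) :
    ∀ k ≤ n, ∃ f, Describes G (State.initial l k) f ∧
      ∀ p ∈ (State.initial l k).rows, p.1 < k ∧ f p.1 = g (k - 1 - p.1)
  | 0, _ => ⟨g, ⟨by simp [State.initial], by simp [State.initial],
      by simp [State.initial, IsTrace], by simp [State.initial]⟩, by simp [State.initial]⟩
  | k + 1, hk => by
    obtain ⟨f, hf, hrow⟩ := Describes.initial hG hg k (by omega)
    refine ⟨_, hf.extend hG (x := g k) (fun p hp => ?_) (fun p hp => ?_), fun p hp => ?_⟩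
    · obtain ⟨hlt, he⟩ := hrow p hp
      rw [he, ← (hg k hk (k - 1 - p.1) (by omega)).2]
      congr! 2
      omega
    · obtain ⟨hlt, he⟩ := hrow p hp
      exact he ▸ (hg k hk (k - 1 - p.1) (by omega)).1
    · simp only [State.initial, State.extend, List.mem_cons, List.mem_map] at hp
      obtain rfl | ⟨q, hq, rfl⟩ := hp
      · exact ⟨by simp, by simp⟩
      · obtain ⟨hlt, he⟩ := hrow q hq
        refine ⟨by simpa using hlt, ?_⟩
        simp only [he]
        congr 1
        omega

theorem colorable_of_contains (hG : PatternFree G) {H : SimpleGraph (Fin 6)} (h : Contains G H)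
    {l : List ℕ}
    (hl : ∀ k i : Fin 6, i < k → ((l.getD k 0).testBit (k - 1 - i) = true ↔ H.Adj k i))
    {T : Cases} (hT : T.check (State.initial l 6) = true) : G.Colorable 7 := by
  obtain ⟨φ⟩ := h
  obtain ⟨f, hf, -⟩ := Describes.initial hG (l := l) (g := fun k => φ (Fin.ofNat 6 k)) (n := 6)
    (fun k hk i hi => by
      have h1 : ((Fin.ofNat 6 k : Fin 6) : ℕ) = k := Nat.mod_eq_of_lt hk
      have h2 : ((Fin.ofNat 6 i : Fin 6) : ℕ) = i := Nat.mod_eq_of_lt (hi.trans hk)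
      have hlt : Fin.ofNat 6 i < Fin.ofNat 6 k := by rw [Fin.lt_def, h1, h2]; exact hi
      have := hl _ _ hlt
      rw [h1, h2] at this
      exact ⟨fun he => hlt.ne (φ.injective he), this.trans φ.map_rel_iff.symm⟩) 6 le_rfl
  exact hf.colorable_of_check hG hT

/-- The case distinction for co-A. -/
def casesCoA : Cases :=
  .vertex 10 (.vertex 114 (.leaf 845270 2889015161291622014339326035908863620519175217239923403984)
    (.vertex 113 (.leaf 1683326 35264320900425080174775981793978924910164006472) (.vertex 50 (.leaf
    845478 4317233678759993141276550953124786746255038448) (.vertex 90 (.leaf 711229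
    2385157951900840025530854605497864645366767569136724095655044130607522888) (.vertex 44 (.leaf
    845335 40536215597123675789935370511518589595109035288502357999543481724360) (.vertex 8 (.leaf
    4276523 229701431643358340705098966231333769905913381073006571099433648) (.leaf 132757
    2878755264307249397399784057556204895884067312))))))) (.vertex 24 (.leaf 643517
    22088748601996887120463301692848) (.vertex 56 (.leaf 256984
    15286713110882777992006173572100596039554376) (.vertex 7 (.leaf 24759
    611844995293233005995491324460817850712872) (.vertex 11 (.leaf 240455
    223946233943894898937584436103192742411816848087346904) (.vertex 4 (.vertex 100 (.leaf 2709029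
    1911527437927739569633664110065404105957323843583872169285837879745064040096) (.vertex 114
    (.leaf 4188395 488709399406313336689538816871220357859878440712621732752) (.vertex 45 (.leaf
    173320 114852169776352258690931971036730259624907456236858066944452744) (.vertex 50 (.vertex 180
    (.leaf 1669327 517979258550726453815846295593542885506802703308504608000) (.leaf 847219
    169375914223645714565900125872844168812243117447240)) (.vertex 54 (.vertex 230 (.leaf 6434788
    2430372522683691750639744341131785275499574212056151011688) (.leaf 1750408
    4155580735379865497480711299684869201698905115400904)) (.vertex 73 (.leaf 864472
    71752211286664669596906108854441951875397195075886571181344) (.vertex 35 (.leaf 1418306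
    169411121275179407475968401709632502128584505481608) (.vertex 84 (.leaf 1194004
    13241942982082102768651897753011077599917405555630988112772227657640) (.vertex 52 (.leaf 4977386
    4148915739938317685074199906104032352359636363881504) (.vertex 44 (.leaf 122934
    2343892557918647421742820207609516144985027156771244258522032) (.leaf 398620
    35969606459641734404977915882309113043096))))))))))) (.leaf 18622
    12479244943084622823501543343186027868032))))))

/-- The case distinction for co-domino. -/
def casesCoDomino : Cases :=
  .edge 36 (.vertex 224 (.leaf 14068055 6911861751135055640959665323051101040786564749271) (.vertex
    218 (.leaf 6017636 2898964090587791218065235697085082068647062241023967599536) (.vertex 186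
    (.leaf 7430096 119586326126644971084771108636615106146060861585075186376744) (.vertex 230 (.leaf
    6061199 614025565432171005897668383715254471520295012541905408) (.vertex 234 (.leaf 11815693
    23917864615820621616995870263547152529648653943691206403960) (.vertex 94 (.leaf 17899817
    215822892480259816104335745775518772048590074046931608) (.vertex 62 (.leaf 27330635
    30543813853708500713322879943169322448468856) (.vertex 233 (.leaf 5967957
    19922754562324247065291390326212365940901959717085445240) (.vertex 93 (.leaf 12135196
    1219506478777285395561844411113564795196693375910153480) (.vertex 39 (.leaf 11681466
    1498718373063338573466292225277095059999159) (.vertex 170 (.vertex 149 (.leaf 15669430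
    1834420262128201521854534807723622880940315672000) (.vertex 223 (.leaf 55898634
    27024139115415987357655119696286399600683191394912962555293723321528) (.vertex 340 (.leaf
    85324680 1174327072605145208784743161095235764971376948470019630359888) (.vertex 364 (.leaf
    6155599 824287101856590205365808073802126211335741118920993363137787348784) (.leaf 10304422
    2158188028339661596177371146927614725142959608))))) (.vertex 182 (.leaf 33939180
    4236970056554701968526198210952030472008398565760760) (.leaf 287555
    15285639939592347908088095084158213543))))))))))))) (.vertex 56 (.leaf 34168
    2549905707056236464347286682922316360) (.vertex 11 (.leaf 420773
    778417275251732917622422157904951281123999256) (.vertex 58 (.leaf 17733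
    3458766305581788984648672951245529721549450249296) (.vertex 7 (.leaf 305075
    27419107369765106206013211224) (.vertex 57 (.leaf 120983
    171070039817998222551182895725002143238387324898056) (.vertex 42 (.leaf 386936
    8639770312451652627889931749859485658258351790088) (.leaf 17570
    54102159769836496335779412767)))))))

theorem check_casesCoA : casesCoA.check (State.initial [0, 1, 1, 7, 9, 17] 6) = true := by
  decide +kernel

theorem check_casesCoDomino :
    casesCoDomino.check (State.initial [0, 1, 1, 3, 9, 17] 6) = true := by
  decide +kernel

end TraceColoring

theorem chromatic_le_seven_of_coDomino_or_coA {V : Type*} [Fintype V] (G : SimpleGraph V)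
    (hP : ¬ Contains G P3P2) (hK : ¬ Contains G (completeGraph (Fin 4)))
    (h : Contains G coDomino ∨ Contains G coA) :
    G.chromaticNumber ≤ 7 := by
  have hG := TraceColoring.PatternFree.of_not_contains hP hK
  refine SimpleGraph.Colorable.chromaticNumber_le ?_
  obtain h | h := h
  · refine TraceColoring.colorable_of_contains hG h ?_ TraceColoring.check_casesCoDomino
    simp [coDomino, Fin.forall_fin_succ, Nat.testBit_eq_decide_div_mod_eq]
  · refine TraceColoring.colorable_of_contains hG h ?_ TraceColoring.check_casesCoA
    simp [coA, Fin.forall_fin_succ, Nat.testBit_eq_decide_div_mod_eq]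
end

section
/- If G is a (4K₁, co-(P₃∪P₂))-free graph with n vertices and clique number ω, then n ≤ 7ω. -/
open SimpleGraph

section

open scoped Classical

variable {V : Type*} {H : SimpleGraph V} {α : ℕ}

/-- No two vertices of `s` are adjacent in `H`. -/
def Independent (H : SimpleGraph V) (s : Finset V) : Prop :=
  ∀ x ∈ s, ∀ y ∈ s, ¬ H.Adj x y

/-- `H` has no `K₄`, no induced `P₃ ∪ P₂`, and no independent set with more than `α`
vertices. -/
structure Sparse (H : SimpleGraph V) (α : ℕ) : Prop where
  k4 : ∀ {p q r s : V}, H.Adj p q → H.Adj p r → H.Adj p s → H.Adj q r → H.Adj q s →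
    H.Adj r s → False
  p3p2 : ∀ {p q r s t : V}, p ≠ r → H.Adj p q → H.Adj q r → ¬ H.Adj p r → H.Adj s t →
    H.Adj p s ∨ H.Adj p t ∨ H.Adj q s ∨ H.Adj q t ∨ H.Adj r s ∨ H.Adj r t
  card_le : ∀ s : Finset V, Independent H s → s.card ≤ α

theorem Contains.of_adj_iff {W : Type*} {G : SimpleGraph V} {K : SimpleGraph W} (f : W → V)
    (hf : f.Injective) (h : ∀ i j, G.Adj (f i) (f j) ↔ K.Adj i j) : Contains G K :=
  ⟨⟨⟨f, hf⟩, h _ _⟩⟩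

theorem sparse_compl [Fintype V] (G : SimpleGraph V) (h1 : ¬ Contains G (⊥ : SimpleGraph (Fin 4)))
    (h2 : ¬ Contains G P3P2ᶜ) : Sparse Gᶜ G.cliqueNum where
  k4 := by
    intro p q r s hpq hpr hps hqr hqs hrs
    simp only [compl_adj] at hpq hpr hps hqr hqs hrs
    refine h1 (.of_adj_iff ![p, q, r, s] ?_ ?_)
    · intro i j
      fin_cases i <;> fin_cases j <;>
        simp [hpq.1, hpr.1, hps.1, hqr.1, hqs.1, hrs.1, hpq.1.symm, hpr.1.symm, hps.1.symm,
          hqr.1.symm, hqs.1.symm, hrs.1.symm]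
    · intro i j
      fin_cases i <;> fin_cases j <;>
        simp [hpq.2, hpr.2, hps.2, hqr.2, hqs.2, hrs.2, G.adj_comm q p, G.adj_comm r p,
          G.adj_comm s p, G.adj_comm r q, G.adj_comm s q, G.adj_comm s r]
  p3p2 := by
    intro p q r s t hne hpq hqr hpr hst
    by_contra! hcon
    simp only [compl_adj] at hpq hqr hpr hst hcon
    obtain ⟨h3, h4, h5, h6, h7, h8⟩ := hcon
    have hs : p ≠ s ∧ p ≠ t ∧ q ≠ s ∧ q ≠ t ∧ r ≠ s ∧ r ≠ t := by
      refine ⟨?_, ?_, ?_, ?_, ?_, ?_⟩ <;> rintro rfl <;> simp_all [G.adj_comm]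
    obtain ⟨k3, k4, k5, k6, k7, k8⟩ := hs
    have g1 : G.Adj p r := by simp_all
    have g3 : G.Adj p s := by simp_all
    have g4 : G.Adj p t := by simp_all
    have g5 : G.Adj q s := by simp_all
    have g6 : G.Adj q t := by simp_all
    have g7 : G.Adj r s := by simp_all
    have g8 : G.Adj r t := by simp_all
    have hp : ¬ G.Adj q p := fun h => hpq.2 h.symm
    have hq : ¬ G.Adj r q := fun h => hqr.2 h.symm
    have ht : ¬ G.Adj t s := fun h => hst.2 h.symm
    refine h2 (.of_adj_iff ![p, q, r, s, t] ?_ ?_)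
    · intro i j
      fin_cases i <;> fin_cases j <;>
        simp [hpq.1, hqr.1, hst.1, hpq.1.symm, hqr.1.symm, hst.1.symm, g1.ne, g3.ne, g4.ne,
          g5.ne, g6.ne, g7.ne, g8.ne, g1.ne', g3.ne', g4.ne', g5.ne', g6.ne', g7.ne', g8.ne']
    · intro i j
      fin_cases i <;> fin_cases j <;>
        simp [P3P2, hp, hq, ht, hpq.2, hqr.2, hst.2, g1, g3, g4, g5, g6, g7, g8, g1.symm,
          g3.symm, g4.symm, g5.symm, g6.symm, g7.symm, g8.symm]
  card_le := by
    intro s hs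
    refine IsClique.card_le_cliqueNum (G := G) (t := s) (tc := fun x hx y hy hxy => ?_)
    have := hs x hx y hy
    simp only [compl_adj] at this
    tauto

theorem exists_maximal_independent (H : SimpleGraph V) (S : Finset V) :
    ∃ I ⊆ S, Independent H I ∧ ∀ v ∈ S, v ∉ I → ∃ i ∈ I, H.Adj v i := by
  obtain ⟨I, hI, hmax⟩ := Finset.exists_max_image
    (S.powerset.filter fun I => Independent H I) Finset.card
    ⟨∅, Finset.mem_filter.2 ⟨by simp, by simp [Independent]⟩⟩
  simp only [Finset.mem_filter, Finset.mem_powerset] at hI hmax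
  refine ⟨I, hI.1, hI.2, fun v hv hvI => ?_⟩
  by_contra! hcon
  have := hmax (insert v I) ⟨Finset.insert_subset hv hI.1, ?_⟩
  · rw [Finset.card_insert_of_notMem hvI] at this
    omega
  · have := hI.2
    intro x hx y hy hxy
    have := hxy.symm
    have := hxy.ne
    unfold Independent at *
    grind

/-- Adjacency is transitive on distinct vertices of `S`: no induced `P₃` inside `S`. -/
def P3Free (H : SimpleGraph V) (S : Finset V) : Prop :=
  ∀ x ∈ S, ∀ y ∈ S, ∀ z ∈ S, H.Adj x y → H.Adj y z → x ≠ z → H.Adj x z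

theorem exists_independent_card_le_three_mul (hH : Sparse H α) {S : Finset V}
    (hS : P3Free H S) : ∃ I ⊆ S, Independent H I ∧ S.card ≤ 3 * I.card := by
  obtain ⟨I, hIS, hI, hmax⟩ := exists_maximal_independent H S
  have : ∀ v, ∃ i, v ∈ S → i ∈ I ∧ (v = i ∨ H.Adj v i) := by
    intro v
    by_cases hv : v ∈ S
    · by_cases hvI : v ∈ I
      · exact ⟨v, fun _ => ⟨hvI, Or.inl rfl⟩⟩
      · obtain ⟨i, hi, h⟩ := hmax v hv hvI
        exact ⟨i, fun _ => ⟨hi, Or.inr h⟩⟩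
    · exact ⟨v, fun h => absurd h hv⟩
  choose f hf using this
  refine ⟨I, hIS, hI, ?_⟩
  refine (Finset.card_le_mul_card_image (f := f) S 3 ?_).trans
    (Nat.mul_le_mul_left 3 (Finset.card_le_card fun i hi => ?_))
  · intro i hi
    by_contra! hcon
    have hclique : ∀ x ∈ S.filter (f · = i), ∀ y ∈ S.filter (f · = i), x ≠ y → H.Adj x y := by
      intro x hx y hy hxy
      simp only [Finset.mem_filter] at hx hy
      have h1 := hf x hx.1
      have h2 := hf y hy.1
      rw [hx.2] at h1
      rw [hy.2] at h2
      have hi' := hIS h1.1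
      rcases h1.2 with rfl | h3 <;> rcases h2.2 with rfl | h4
      · exact absurd rfl hxy
      · exact h4.symm
      · exact h3
      · exact hS x hx.1 i hi' y hy.1 h3 h4.symm hxy
    obtain ⟨T, hT, hTc⟩ := Finset.exists_subset_card_eq (n := 4) (s := S.filter (f · = i)) hcon
    obtain ⟨p, q, r, s, hpq, hpr, hps, hqr, hqs, hrs, rfl⟩ := Finset.card_eq_four.1 hTc
    have hc : ∀ x ∈ ({p, q, r, s} : Finset V), ∀ y ∈ ({p, q, r, s} : Finset V), x ≠ y →
        H.Adj x y := fun x hx y hy => hclique x (hT hx) y (hT hy)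
    apply hH.k4 (p := p) (q := q) (r := r) (s := s) <;> apply hc <;> simp_all
  · obtain ⟨v, hv, rfl⟩ := Finset.mem_image.1 hi
    exact (hf v hv).1

/-- A windmill with hub `a`: pairwise anticomplete edges `x (π x)`, `x ∈ W`, all joined to `a`. -/
structure Windmill (H : SimpleGraph V) (a : V) (W : Finset V) (π : V → V) : Prop where
  adj : ∀ x ∈ W, H.Adj x (π x)
  hub : ∀ x ∈ W, H.Adj a x ∧ H.Adj a (π x)
  sep : ∀ x ∈ W, ∀ y ∈ W, x ≠ y → ¬ H.Adj x y ∧ ¬ H.Adj x (π y) ∧ ¬ H.Adj (π x) (π y)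

/-- `u` is a neighbour of `a` off the windmill adjacent to exactly one end of each edge
`x (π x)`, `x ∈ W`. -/
def Splits (H : SimpleGraph V) (a : V) (W : Finset V) (π : V → V) (u : V) : Prop :=
  H.Adj a u ∧ ∀ x ∈ W, (H.Adj u x ↔ ¬ H.Adj u (π x)) ∧ u ≠ x ∧ u ≠ π x

variable {a u v w : V} {W S : Finset V} {π : V → V}

theorem Windmill.ends_sep (hW : Windmill H a W π) {x y p q : V} (hx : x ∈ W) (hy : y ∈ W)
    (hxy : x ≠ y) (hp : p = x ∨ p = π x) (hq : q = y ∨ q = π y) : ¬ H.Adj p q ∧ p ≠ q := by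
  have h1 := hW.sep x hx y hy hxy
  have h2 := hW.sep y hy x hx hxy.symm
  have h3 := hW.adj x hx
  have h4 := hW.adj y hy
  rcases hp with rfl | rfl <;> rcases hq with rfl | rfl <;>
    refine ⟨?_, ?_⟩ <;> simp_all [H.adj_comm] <;> intro h <;> simp_all

theorem Splits.exists_ends (hu : Splits H a W π u) (hv : Splits H a W π v) {x : V} (hx : x ∈ W)
    (hne : ¬ (H.Adj u x ↔ H.Adj v x)) : ∃ p q, (p = x ∨ p = π x) ∧ (q = x ∨ q = π x) ∧
      H.Adj u p ∧ ¬ H.Adj v p ∧ H.Adj v q ∧ ¬ H.Adj u q := by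
  have h1 := hu.2 x hx
  have h2 := hv.2 x hx
  by_cases h : H.Adj u x
  · exact ⟨x, π x, by tauto⟩
  · exact ⟨π x, x, by tauto⟩

theorem Splits.adj_iff (hu : Splits H a W π u) (hv : Splits H a W π v) {x p : V} (hx : x ∈ W)
    (h : H.Adj u x ↔ H.Adj v x) (hp : p = x ∨ p = π x) : H.Adj u p ↔ H.Adj v p := by
  have h1 := hu.2 x hx
  have h2 := hv.2 x hx
  rcases hp with rfl | rfl <;> tauto

theorem card_differ_le_two (hH : Sparse H α) (hW : Windmill H a W π) (hu : Splits H a W π u)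
    (hv : Splits H a W π v) (huv : ¬ H.Adj u v) :
    (W.filter fun x => ¬ (H.Adj u x ↔ H.Adj v x)).card ≤ 2 := by
  by_contra hcon
  rw [not_le] at hcon
  obtain ⟨x, hx, y, hy, z, hz, hxy, hxz, hyz⟩ := Finset.two_lt_card.1 hcon
  rw [Finset.mem_filter] at hx hy hz
  obtain ⟨p, _, hp, _, hup, hvp, _⟩ := hu.exists_ends hv hx.1 hx.2
  obtain ⟨q, _, hq, _, huq, hvq, _⟩ := hu.exists_ends hv hy.1 hy.2
  obtain ⟨_, r, _, hr, _, _, hvr, hur⟩ := hu.exists_ends hv hz.1 hz.2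
  have h1 := hW.ends_sep hx.1 hy.1 hxy hp hq
  have h2 := hW.ends_sep hx.1 hz.1 hxz hp hr
  have h3 := hW.ends_sep hy.1 hz.1 hyz hq hr
  have := hH.p3p2 h1.2 hup.symm huq h1.1 hvr
  simp_all [H.adj_comm]

theorem differ_of_adj (hH : Sparse H α) (hW : Windmill H a W π) (hu : Splits H a W π u)
    (hv : Splits H a W π v) (huv : H.Adj u v) : ∀ x ∈ W, (H.Adj u x ↔ ¬ H.Adj v x) := by
  intro x hx
  have h1 := hu.2 x hx
  have h2 := hv.2 x hx
  have h3 := hW.hub x hx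
  have k1 := fun h h' => hH.k4 hu.1 hv.1 h3.1 huv h h'
  have k2 := fun h h' => hH.k4 hu.1 hv.1 h3.2 huv h h'
  tauto

/-- An independent set meeting no `u`-side of the windmill can be enlarged by those ends of the
windmill edges that are not adjacent to `u`. -/
theorem card_add_card_le (hH : Sparse H α) (hW : Windmill H a W π)
    (hS : Independent H S)
    (hSW : ∀ s ∈ S, ∀ x ∈ W, (H.Adj u x → ¬ H.Adj s (π x) ∧ s ≠ π x) ∧
      (¬ H.Adj u x → ¬ H.Adj s x ∧ s ≠ x)) : S.card + W.card ≤ α := by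
  set f : V → V := fun x => if H.Adj u x then π x else x with hf
  have hfx : ∀ x, f x = x ∨ f x = π x := by
    intro x
    by_cases h : H.Adj u x <;> simp [hf, h]
  have hSf : ∀ s ∈ S, ∀ x ∈ W, ¬ H.Adj s (f x) ∧ s ≠ f x := by
    intro s hs x hx
    have := hSW s hs x hx
    by_cases h : H.Adj u x <;> simp_all
  have hinj : Set.InjOn f W := by
    intro x hx y hy hxy
    by_contra hne
    exact (hW.ends_sep hx hy hne (hfx x) (hfx y)).2 hxy
  rw [← Finset.card_image_of_injOn hinj, ← Finset.card_union_of_disjoint]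
  · apply hH.card_le
    intro p hp q hq
    simp only [Finset.mem_union, Finset.mem_image] at hp hq
    rcases hp with hp | ⟨x, hx, rfl⟩ <;> rcases hq with hq | ⟨y, hy, rfl⟩
    · exact hS p hp q hq
    · exact (hSf p hp y hy).1
    · exact fun h => (hSf q hq x hx).1 h.symm
    · by_cases hxy : x = y
      · subst hxy
        exact H.irrefl
      · exact (hW.ends_sep hx hy hxy (hfx x) (hfx y)).1
  · rw [Finset.disjoint_left]
    intro p hp hq
    obtain ⟨x, hx, rfl⟩ := Finset.mem_image.1 hq
    exact (hSf _ hp x hx).2 rfl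

theorem card_add_card_le_of_same (hH : Sparse H α) (hW : Windmill H a W π)
    (hS : Independent H S) (hSs : ∀ s ∈ S, Splits H a W π s)
    (hSu : ∀ s ∈ S, ∀ x ∈ W, (H.Adj u x ↔ H.Adj s x)) : S.card + W.card ≤ α := by
  refine card_add_card_le (u := u) hH hW hS fun s hs x hx => ?_
  have h1 := (hSs s hs).2 x hx
  have h2 := hSu s hs x hx
  tauto

theorem card_le_four_or_card_add_card_le (hH : Sparse H α) (hW : Windmill H a W π)
    (huS : u ∈ S) (hw : Splits H a W π w) (huw : H.Adj u w) (hS : Independent H S)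
    (hSs : ∀ s ∈ S, Splits H a W π s) {b : V} (hb : b ∈ W)
    (hSb : ∀ s ∈ S, (H.Adj s b ↔ H.Adj u b)) (hcard : 4 ≤ W.card) :
    S.card + W.card ≤ α ∨ W.card = 4 ∧ S.card ≤ 4 := by
  set D : V → Finset V := fun s => W.filter fun x => ¬ (H.Adj u x ↔ H.Adj s x) with hD
  have hu := hSs u huS
  have huw' := differ_of_adj hH hW hu hw huw
  have hDle : ∀ s ∈ S, (D s).card ≤ 2 := fun s hs =>
    card_differ_le_two hH hW hu (hSs s hs) (hS u huS s hs)
  have hDge : ∀ s ∈ S, (D s).card ≠ 0 → W.card = 4 ∧ (D s).card = 2 := by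
    intro s hs hne
    have hsw : ¬ H.Adj s w := by
      intro hsw
      apply hne
      have := differ_of_adj hH hW (hSs s hs) hw hsw
      rw [Finset.card_eq_zero, Finset.filter_eq_empty_iff]
      intro x hx
      have h1 := huw' x hx
      have h2 := this x hx
      tauto
    have h1 := card_differ_le_two hH hW (hSs s hs) hw hsw
    have h2 : (W.filter fun x => (H.Adj u x ↔ H.Adj s x)).card ≤ 2 := by
      refine le_trans (Finset.card_le_card fun x hx => ?_) h1
      rw [Finset.mem_filter] at hx ⊢
      have h2 := huw' x hx.1
      tauto
    have h3 := Finset.card_filter_add_card_filter_not (s := W)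
      (fun x => (H.Adj u x ↔ H.Adj s x))
    have h4 := hDle s hs
    simp only [hD] at h4 ⊢
    omega
  by_cases hconst : ∀ s ∈ S, (D s).card = 0
  · left
    refine card_add_card_le_of_same (u := u) hH hW hS hSs fun s hs x hx => ?_
    have := hconst s hs
    rw [Finset.card_eq_zero, Finset.filter_eq_empty_iff] at this
    simpa using this hx
  · right
    push Not at hconst
    obtain ⟨v, hv, hvD⟩ := hconst
    have h4 := hDge v hv hvD
    refine ⟨h4.1, ?_⟩
    have key : ∀ s ∈ S, ∀ t ∈ S, s ≠ t → (∀ x ∈ W, (H.Adj s x ↔ H.Adj t x)) → ∀ r ∈ S,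
        (W.filter fun x => ¬ (H.Adj s x ↔ H.Adj r x)).card ≤ 1 := by
      intro s hs t ht hst hsame r hr
      by_contra hcon
      rw [not_le] at hcon
      obtain ⟨x, hx, y, hy, hxy⟩ := Finset.one_lt_card.1 hcon
      rw [Finset.mem_filter] at hx hy
      obtain ⟨p, _, hp, _, hsp, hrp, _⟩ := (hSs s hs).exists_ends (hSs r hr) hx.1 hx.2
      obtain ⟨_, q, _, hq, _, _, hrq, hsq⟩ := (hSs s hs).exists_ends (hSs r hr) hy.1 hy.2
      have h1 := hW.ends_sep hx.1 hy.1 hxy hp hq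
      have h2 := (hSs s hs).adj_iff (hSs t ht) hx.1 (hsame x hx.1) hp
      have h3 := (hSs s hs).adj_iff (hSs t ht) hy.1 (hsame y hy.1) hq
      have h4 := hS s hs t ht
      have h5 := hS s hs r hr
      have h6 := hS t ht r hr
      have := hH.p3p2 hst hsp (h2.1 hsp).symm h4 hrq
      simp_all [H.adj_comm]
    have hinj : Set.InjOn D S := by
      intro s hs t ht hst
      by_contra hne
      have hsame : ∀ x ∈ W, (H.Adj s x ↔ H.Adj t x) := by
        intro x hx
        have := Finset.ext_iff.1 hst x
        simp only [hD] at this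
        rw [Finset.mem_filter, Finset.mem_filter] at this
        tauto
      have h5 := key s hs t ht hne hsame
      by_cases h0 : (D s).card = 0
      · rw [Finset.card_eq_zero, Finset.filter_eq_empty_iff] at h0
        have h6 : D v ⊆ W.filter fun x => ¬ (H.Adj s x ↔ H.Adj v x) := by
          intro x hx
          rw [Finset.mem_filter] at hx ⊢
          have := h0 hx.1
          tauto
        have := (Finset.card_le_card h6).trans (h5 v hv)
        omega
      · have h6 : D s ⊆ W.filter fun x => ¬ (H.Adj s x ↔ H.Adj u x) := by
          intro x hx
          rw [Finset.mem_filter] at hx ⊢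
          tauto
        have := (Finset.card_le_card h6).trans (h5 u huS)
        have := hDge s hs h0
        omega
    have hmap : ∀ s ∈ S, D s ∈ (W.erase b).powersetCard 0 ∪ (W.erase b).powersetCard 2 := by
      intro s hs
      have hsub : D s ⊆ W.erase b := by
        intro x hx
        rw [Finset.mem_filter] at hx
        rw [Finset.mem_erase]
        refine ⟨?_, hx.1⟩
        rintro rfl
        exact hx.2 (hSb s hs).symm
      rw [Finset.mem_union, Finset.mem_powersetCard, Finset.mem_powersetCard]
      have := hDge s hs
      tauto
    refine (Finset.card_le_card_of_injOn D hmap hinj).trans ?_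
    refine (Finset.card_union_le _ _).trans ?_
    rw [Finset.card_powersetCard, Finset.card_powersetCard, Finset.card_erase_of_mem hb, h4.1]
    decide

/-- `I` is an independent subset of `X`, and every vertex of the rest `R` of `X` has exactly one
neighbour `π x` in `I`; the edges `x (π x)` are pairwise anticomplete. -/
structure Matched (H : SimpleGraph V) (X I R : Finset V) (π : V → V) : Prop where
  subset_left : I ⊆ X
  subset_right : R ⊆ X
  disj : ∀ x ∈ R, x ∉ I
  card_eq : X.card = I.card + R.card
  indep : Independent H I
  partner : ∀ x ∈ R, π x ∈ I ∧ H.Adj x (π x)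
  uniq : ∀ x ∈ R, ∀ i ∈ I, H.Adj x i → i = π x
  sep : ∀ x ∈ R, ∀ y ∈ R, x ≠ y → ¬ H.Adj x y ∧ ¬ H.Adj x (π y) ∧ ¬ H.Adj (π x) (π y)

theorem exists_matched {X : Finset V} (hX : P3Free H X)
    (htri : ∀ x ∈ X, ∀ y ∈ X, ∀ z ∈ X, H.Adj x y → H.Adj y z → H.Adj x z → False) :
    ∃ I R π, Matched H X I R π := by
  obtain ⟨I, hIX, hI, hmax⟩ := exists_maximal_independent H X
  have : ∀ v, ∃ i, v ∈ X \ I → i ∈ I ∧ H.Adj v i := by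
    intro v
    by_cases hv : v ∈ X \ I
    · rw [Finset.mem_sdiff] at hv
      obtain ⟨i, hi⟩ := hmax v hv.1 hv.2
      exact ⟨i, fun _ => hi⟩
    · exact ⟨v, fun h => absurd h hv⟩
  choose π hπ using this
  have huniq : ∀ x ∈ X \ I, ∀ i ∈ I, H.Adj x i → i = π x := by
    intro x hx i hi hxi
    by_contra hne
    have hx' := (Finset.mem_sdiff.1 hx).1
    have := hπ x hx
    exact hI i hi _ this.1 (hX i (hIX hi) x hx' _ (hIX this.1) hxi.symm this.2 hne)
  have hnadj : ∀ x ∈ X \ I, ∀ y ∈ X \ I, ¬ H.Adj x y := by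
    intro x hx y hy hxy
    have hx' := Finset.mem_sdiff.1 hx
    have hy' := Finset.mem_sdiff.1 hy
    have h := hπ x hx
    have hne : π x ≠ y := fun h' => hy'.2 (h' ▸ h.1)
    exact htri _ (hIX h.1) x hx'.1 y hy'.1 h.2.symm hxy
      (hX _ (hIX h.1) x hx'.1 y hy'.1 h.2.symm hxy hne)
  refine ⟨I, X \ I, π, hIX, Finset.sdiff_subset, fun x hx => (Finset.mem_sdiff.1 hx).2, ?_, hI, hπ,
    huniq, ?_⟩
  · have := Finset.card_sdiff_add_card_eq_card hIX
    omega
  · intro x hx y hy hxy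
    have h := hπ x hx
    have h' := hπ y hy
    refine ⟨hnadj x hx y hy, fun hadj => ?_, hI _ h.1 _ h'.1⟩
    exact hnadj x hx y hy (hX x (Finset.mem_sdiff.1 hx).1 _ (hIX h'.1) y (Finset.mem_sdiff.1 hy).1
      hadj h'.2.symm hxy)

theorem p3Free_of_edge (hH : Sparse H α) {b c : V} (hbc : H.Adj b c)
    (hS : ∀ v ∈ S, ¬ H.Adj b v ∧ ¬ H.Adj c v) : P3Free H S := by
  intro x hx y hy z hz hxy hyz hxz
  by_contra hadj
  have h1 := hS x hx
  have h2 := hS y hy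
  have h3 := hS z hz
  have := hH.p3p2 hxz hxy hyz hadj hbc
  simp_all [H.adj_comm]

theorem card_succ_le (hH : Sparse H α) (hS : Independent H S) {p : V} (hp : p ∉ S)
    (hpS : ∀ s ∈ S, ¬ H.Adj p s) : S.card + 1 ≤ α := by
  rw [← Finset.card_insert_of_notMem hp]
  apply hH.card_le
  intro x hx y hy
  rw [Finset.mem_insert] at hx hy
  rcases hx with rfl | hx <;> rcases hy with rfl | hy
  · exact H.irrefl
  · exact hpS y hy
  · exact fun h => hpS x hx h.symm
  · exact hS x hx y hy

theorem Independent.union {T : Finset V} (hS : Independent H S) (hT : Independent H T)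
    (hST : ∀ s ∈ S, ∀ t ∈ T, ¬ H.Adj s t) : Independent H (S ∪ T) := by
  intro x hx y hy
  rw [Finset.mem_union] at hx hy
  rcases hx with hx | hx <;> rcases hy with hy | hy
  · exact hS x hx y hy
  · exact hST x hx y hy
  · exact fun h => hST y hy x hx h.symm
  · exact hT x hx y hy

variable {b c : V}

theorem windmill_insert (hab : H.Adj a b) (hbc : H.Adj b c) (hca : H.Adj c a) {X I R : Finset V}
    (hX : ∀ v ∈ X, H.Adj a v ∧ ¬ H.Adj b v ∧ ¬ H.Adj c v) (hM : Matched H X I R π) :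
    Windmill H a (insert b R) (Function.update π b c) := by
  have hbR : ∀ x ∈ R, x ≠ b := by
    rintro x hx rfl
    exact (hX x (hM.subset_right hx)).2.2 hbc.symm
  have hR := fun x hx => hX x (hM.subset_right hx)
  have hπ := fun x hx => hX _ (hM.subset_left (hM.partner x hx).1)
  refine ⟨?_, ?_, ?_⟩
  · intro x hx
    rcases Finset.mem_insert.1 hx with rfl | hx
    · simpa using hbc
    · simpa [Function.update_of_ne (hbR x hx)] using (hM.partner x hx).2
  · intro x hx
    rcases Finset.mem_insert.1 hx with rfl | hx
    · simpa using ⟨hab, hca.symm⟩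
    · simpa [Function.update_of_ne (hbR x hx)] using ⟨(hR x hx).1, (hπ x hx).1⟩
  · intro x hx y hy hxy
    rcases Finset.mem_insert.1 hx with rfl | hx' <;> rcases Finset.mem_insert.1 hy with rfl | hy'
    · exact absurd rfl hxy
    · have h1 := hR y hy'
      have h2 := hπ y hy'
      simp [Function.update_of_ne (hbR y hy'), h1, h2]
    · have h1 := hR x hx'
      have h2 := hπ x hx'
      simp [Function.update_of_ne (hbR x hx'), H.adj_comm x, H.adj_comm (π x), h1, h2]
    · simpa [Function.update_of_ne (hbR x hx'), Function.update_of_ne (hbR y hy')] using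
        hM.sep x hx' y hy' hxy

theorem splits_insert (hH : Sparse H α) (hab : H.Adj a b) (hbc : H.Adj b c) (hca : H.Adj c a)
    {X I R : Finset V} (hX : ∀ v ∈ X, H.Adj a v ∧ ¬ H.Adj b v ∧ ¬ H.Adj c v)
    (hM : Matched H X I R π) (hau : H.Adj a u)
    (hu : H.Adj b u ∧ u ≠ c ∨ H.Adj c u ∧ u ≠ b) :
    Splits H a (insert b R) (Function.update π b c) u := by
  have hbR : ∀ x ∈ R, x ≠ b := by
    rintro x hx rfl
    exact (hX x (hM.subset_right hx)).2.2 hbc.symm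
  have hnot : ¬ (H.Adj b u ∧ H.Adj c u) := fun h => hH.k4 hab hca.symm hau hbc h.1 h.2
  refine ⟨hau, fun x hx => ?_⟩
  rcases Finset.mem_insert.1 hx with rfl | hx
  · have := H.adj_comm u x
    have := H.adj_comm u c
    simp only [Function.update_self]
    refine ⟨by tauto, ?_, ?_⟩ <;> rintro rfl <;> simp_all
  · rw [Function.update_of_ne (hbR x hx)]
    have h1 := hX x (hM.subset_right hx)
    have h2 := hX _ (hM.subset_left (hM.partner x hx).1)
    have h3 := (hM.partner x hx).2
    have h4 : ¬ (H.Adj u x ∧ H.Adj u (π x)) := fun h => hH.k4 hau h1.1 h2.1 h.1 h.2 h3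
    have h5 : H.Adj u x ∨ H.Adj u (π x) := by
      rcases hu with ⟨hu, hne⟩ | ⟨hu, hne⟩
      · have := hH.p3p2 hne.symm hbc.symm hu (by tauto) h3
        tauto
      · have := hH.p3p2 hne.symm hbc hu (by tauto) h3
        tauto
    refine ⟨by tauto, ?_, ?_⟩ <;> rintro rfl <;> tauto

theorem bounds_of_cross_edge (hH : Sparse H α) (hab : H.Adj a b) (hbc : H.Adj b c)
    (hca : H.Adj c a) {X I R S T : Finset V}
    (hX : ∀ v ∈ X, H.Adj a v ∧ ¬ H.Adj b v ∧ ¬ H.Adj c v) (hM : Matched H X I R π)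
    (hS : ∀ v ∈ S, H.Adj a v ∧ H.Adj b v ∧ v ≠ c) (hT : ∀ v ∈ T, H.Adj c v ∧ H.Adj a v ∧ v ≠ b)
    (huS : u ∈ S) (hwT : w ∈ T) (huw : H.Adj u w) :
    R.card + 2 ≤ α ∧ (R.card + 2 = α → I.card + 2 ≤ α) ∧
      (3 ≤ R.card → (S.card + R.card + 1 ≤ α ∨ R.card = 3 ∧ S.card ≤ 4) ∧
        (T.card + R.card + 1 ≤ α ∨ R.card = 3 ∧ T.card ≤ 4)) := by
  have hW := windmill_insert hab hbc hca hX hM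
  have hbR : b ∉ R := fun hb => (hX b (hM.subset_right hb)).2.2 hbc.symm
  have hcard : (insert b R).card = R.card + 1 := Finset.card_insert_of_notMem hbR
  have hSs : ∀ s ∈ S, Splits H a (insert b R) (Function.update π b c) s := fun s hs =>
    splits_insert hH hab hbc hca hX hM (hS s hs).1 (Or.inl (hS s hs).2)
  have hTs : ∀ s ∈ T, Splits H a (insert b R) (Function.update π b c) s := fun s hs =>
    splits_insert hH hab hbc hca hX hM (hT s hs).2.1 (Or.inr ⟨(hT s hs).1, (hT s hs).2.2⟩)
  have hSi : Independent H S := fun x hx y hy hxy =>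
    hH.k4 hab (hS x hx).1 (hS y hy).1 (hS x hx).2.1 (hS y hy).2.1 hxy
  have hTi : Independent H T := fun x hx y hy hxy =>
    hH.k4 hca (hT x hx).1 (hT y hy).1 (hT x hx).2.1 (hT y hy).2.1 hxy
  have hTb : ∀ s ∈ T, ¬ H.Adj s b := fun s hs h =>
    hH.k4 hab hca.symm (hT s hs).2.1 hbc h.symm (hT s hs).1
  refine ⟨?_, ?_, ?_⟩
  · have := card_add_card_le_of_same (S := {u}) (u := u) hH hW (by simp [Independent])
      (by simpa using hSs u huS) (by simp)
    rw [hcard, Finset.card_singleton] at this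
    omega
  · intro hRα
    by_contra hIα
    have hlt : (R.image π).card < I.card := by
      have := Finset.card_image_le (s := R) (f := π)
      omega
    obtain ⟨p, hpI, hpR⟩ := Finset.exists_mem_notMem_of_card_lt_card hlt
    have hp := hX p (hM.subset_left hpI)
    have hadj : ∀ v, Splits H a (insert b R) (Function.update π b c) v → H.Adj v p := by
      intro v hv
      by_contra hvp
      have hvp' : v ≠ p := by
        rintro rfl
        have := hv.2 b (Finset.mem_insert_self b R)
        simp only [Function.update_self, H.adj_comm v] at this
        tauto
      have := card_add_card_le (S := {v, p}) (u := v) hH hW ?_ ?_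
      · rw [Finset.card_pair hvp', hcard] at this
        omega
      · intro x hx y hy
        simp only [Finset.mem_insert, Finset.mem_singleton] at hx hy
        rcases hx with rfl | rfl <;> rcases hy with rfl | rfl <;> simp_all [H.adj_comm]
      · intro s hs x hx
        simp only [Finset.mem_insert, Finset.mem_singleton] at hs
        have h1 := hv.2 x hx
        rcases hs with rfl | rfl
        · tauto
        · rcases Finset.mem_insert.1 hx with rfl | hx
          · simp only [Function.update_self, H.adj_comm s]
            refine ⟨fun _ => ⟨hp.2.2, ?_⟩, fun _ => ⟨hp.2.1, ?_⟩⟩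
            · rintro rfl
              exact hp.2.1 hbc
            · rintro rfl
              exact hp.2.2 hbc.symm
          · have hxb : x ≠ b := fun h => hbR (h ▸ hx)
            rw [Function.update_of_ne hxb]
            have h2 := hM.partner x hx
            refine ⟨fun _ => ⟨hM.indep _ hpI _ h2.1, ?_⟩, fun _ => ⟨fun h => ?_, ?_⟩⟩
            · rintro rfl
              exact hpR (Finset.mem_image_of_mem π hx)
            · rw [hM.uniq x hx s hpI h.symm] at hpR
              exact hpR (Finset.mem_image_of_mem π hx)
            · rintro rfl
              exact hM.disj _ hx hpI
    exact hH.k4 (hS u huS).1 (hT w hwT).2.1 hp.1 huw (hadj u (hSs u huS)) (hadj w (hTs w hwT))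
  · intro h3
    have h1 := card_le_four_or_card_add_card_le hH hW huS (hTs w hwT) huw hSi hSs
      (Finset.mem_insert_self b R) (fun s hs => by
        simp [H.adj_comm _ b, (hS s hs).2.1, (hS u huS).2.1]) (by omega)
    have h2 := card_le_four_or_card_add_card_le hH hW hwT (hSs u huS) huw.symm hTi hTs
      (Finset.mem_insert_self b R) (fun s hs => by
        simp [hTb s hs, hTb w hwT]) (by omega)
    omega

theorem adj_trans_of_edge (hH : Sparse H α) (hbc : H.Adj b c) {x y z : V}
    (hx : ¬ H.Adj b x ∧ ¬ H.Adj c x) (hy : ¬ H.Adj b y ∧ ¬ H.Adj c y)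
    (hz : ¬ H.Adj b z ∧ ¬ H.Adj c z) (hxy : H.Adj x y) (hyz : H.Adj y z) (hne : x ≠ z) :
    H.Adj x z :=
  p3Free_of_edge (S := {x, y, z}) hH hbc (by simp [hx, hy, hz]) x (by simp) y (by simp) z (by simp)
    hxy hyz hne

theorem adj_of_p3_edge (hH : Sparse H α) (hcb : H.Adj c b) {q z p : V} (hbq : H.Adj b q)
    (hcq : ¬ H.Adj c q) (hne : c ≠ q) (hzp : H.Adj z p) (hz : ¬ H.Adj c z ∧ ¬ H.Adj b z)
    (hp : ¬ H.Adj c p ∧ ¬ H.Adj b p) (hqz : ¬ H.Adj q z) : H.Adj q p := by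
  have := hH.p3p2 hne hcb hbq hcq hzp
  tauto

theorem independent_filter_union {I Z : Finset V} (hI : Independent H I) (hZ : Independent H Z) :
    Independent H (I ∪ Z.filter fun z => ¬ ∃ x ∈ I, H.Adj z x) := by
  refine hI.union (fun x hx y hy => hZ x (Finset.mem_filter.1 hx).1 y (Finset.mem_filter.1 hy).1) ?_
  intro x hx z hz hxz
  exact (Finset.mem_filter.1 hz).2 ⟨x, hx, hxz.symm⟩

theorem card_add_card_le_of_touch (hH : Sparse H α) {I Z : Finset V} {p : V}
    (hI : Independent H I) (hZ : Independent H Z) (hpI : ∀ x ∈ I, ¬ H.Adj p x)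
    (hpZ : ∀ z ∈ Z, ¬ H.Adj p z) (hp : p ∉ I) (hp' : p ∉ Z) (hIZ : Disjoint I Z)
    (hle : (Z.filter fun z => ∃ x ∈ I, H.Adj z x).card ≤ 1) : I.card + Z.card ≤ α := by
  have h1 := card_succ_le (p := p) hH (independent_filter_union hI hZ) (by simp [hp, hp']) (by
    intro s hs
    rcases Finset.mem_union.1 hs with hs | hs
    · exact hpI s hs
    · exact hpZ s (Finset.mem_filter.1 hs).1)
  rw [Finset.card_union_of_disjoint (hIZ.mono_right (Finset.filter_subset _ _))] at h1
  have h2 := Finset.card_filter_add_card_filter_not (s := Z) (fun z => ∃ x ∈ I, H.Adj z x)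
  omega

/-- The vertices whose only neighbour in the triangle `abc` is `a`. -/
noncomputable def Private [Fintype V] (H : SimpleGraph V) (a b c : V) : Finset V :=
  Finset.univ.filter fun v => H.Adj a v ∧ ¬ H.Adj b v ∧ ¬ H.Adj c v

/-- The common neighbours of `a` and `b` other than `c`. -/
noncomputable def Common [Fintype V] (H : SimpleGraph V) (a b c : V) : Finset V :=
  Finset.univ.filter fun v => H.Adj a v ∧ H.Adj b v ∧ v ≠ c

theorem mem_private [Fintype V] :
    v ∈ Private H a b c ↔ H.Adj a v ∧ ¬ H.Adj b v ∧ ¬ H.Adj c v := by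
  simp [Private]

theorem mem_common [Fintype V] : v ∈ Common H a b c ↔ H.Adj a v ∧ H.Adj b v ∧ v ≠ c := by
  simp [Common]

theorem remote_card_bound [Fintype V] (hH : Sparse H α) (hab : H.Adj a b) (hbc : H.Adj b c)
    (hca : H.Adj c a) {Z I R J Q L N : Finset V} {π ρ σ : V → V}
    (hM : Matched H (Private H a b c) I R π) (hM' : Matched H (Private H b c a) J Q ρ)
    (hM'' : Matched H (Private H c a b) L N σ) (hZ : Independent H Z)
    (hZt : ∀ z ∈ Z, ¬ H.Adj a z ∧ ¬ H.Adj b z ∧ ¬ H.Adj c z) (hR : 2 ≤ R.card)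
    (hQ : 2 ≤ Q.card) : I.card + Z.card ≤ α ∨ L.card + Z.card ≤ α := by
  have hI := fun x (hx : x ∈ I) => mem_private.1 (hM.subset_left hx)
  have hL := fun x (hx : x ∈ L) => mem_private.1 (hM''.subset_left hx)
  by_contra! hcon
  have hZa : 1 < (Z.filter fun z => ∃ x ∈ I, H.Adj z x).card := by
    by_contra! hle
    have := card_add_card_le_of_touch (p := b) hH hM.indep hZ (fun x hx => (hI x hx).2.1)
      (fun z hz => (hZt z hz).2.1) (fun h => (hI b h).2.2 hbc.symm)
      (fun h => (hZt b h).1 hab) (Finset.disjoint_left.2 fun x hx hz => (hZt x hz).1 (hI x hx).1) hle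
    omega
  have hZc : 1 < (Z.filter fun z => ∃ x ∈ L, H.Adj z x).card := by
    by_contra! hle
    have := card_add_card_le_of_touch (p := b) hH hM''.indep hZ (fun x hx => (hL x hx).2.2)
      (fun z hz => (hZt z hz).2.1) (fun h => (hL b h).2.1 hab)
      (fun h => (hZt b h).1 hab) (Finset.disjoint_left.2 fun x hx hz => (hZt x hz).2.2 (hL x hx).1)
      hle
    omega
  obtain ⟨z₂, hz₂⟩ := Finset.card_pos.1 (zero_lt_one.trans hZc)
  obtain ⟨z₁, hz₁, hne⟩ := Finset.exists_mem_ne hZa z₂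
  obtain ⟨hz₁, x₁, hx₁, h₁⟩ := Finset.mem_filter.1 hz₁
  obtain ⟨hz₂, r₂, hr₂, h₂⟩ := Finset.mem_filter.1 hz₂
  have hx₁' := hI x₁ hx₁
  have hr₂' := hL r₂ hr₂
  have hz₁' := hZt z₁ hz₁
  have hz₂' := hZt z₂ hz₂
  have huntouched : ∀ z ∈ Z, ∀ p ∈ Private H b c a, ∀ q ∈ Private H b c a, H.Adj p q →
      ¬ H.Adj z p := by
    intro z hz p hp q hq hpq hzp
    have hz' := hZt z hz
    rw [mem_private] at hp hq
    have hzq : H.Adj z q := adj_trans_of_edge hH hca ⟨hz'.2.2, hz'.1⟩ hp.2 hq.2 hzp hpq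
      (by rintro rfl; exact hz'.2.1 hq.1)
    have hfree : ∃ x ∈ R, ¬ H.Adj z x ∧ ¬ H.Adj z (π x) := by
      obtain ⟨x, hx, y, hy, hxy⟩ := Finset.one_lt_card.1 hR
      by_contra! hcon
      have hend : ∀ x ∈ R, ∃ e ∈ Private H a b c, (e = x ∨ e = π x) ∧ H.Adj z e := by
        intro x hx
        by_cases h : H.Adj z x
        · exact ⟨x, hM.subset_right hx, Or.inl rfl, h⟩
        · exact ⟨π x, hM.subset_left (hM.partner x hx).1, Or.inr rfl, hcon x hx h⟩
      obtain ⟨e, he, he', hze⟩ := hend x hx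
      obtain ⟨f, hf, hf', hzf⟩ := hend y hy
      have hsep := hM.sep x hx y hy hxy
      have hsep' := hM.sep y hy x hx hxy.symm
      have h3 := (hM.partner x hx).2
      have h4 := (hM.partner y hy).2
      rw [mem_private] at he hf
      have := adj_trans_of_edge hH hbc (x := e) (z := f) he.2 hz'.2 hf.2 hze.symm hzf
      rcases he' with rfl | rfl <;> rcases hf' with rfl | rfl <;> simp_all [H.adj_comm]
    obtain ⟨x, hx, hzx, hzπ⟩ := hfree
    have hx' := mem_private.1 (hM.subset_right hx)
    have hπ := hI _ (hM.partner x hx).1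
    have key : ∀ e, H.Adj a e ∧ ¬ H.Adj b e ∧ ¬ H.Adj c e → ¬ H.Adj z e →
        H.Adj e p ∧ H.Adj e q := by
      intro e he hze
      have hne : c ≠ e := by
        rintro rfl
        exact he.2.1 hbc
      exact ⟨adj_of_p3_edge hH hca he.1 he.2.2 hne hzp ⟨hz'.2.2, hz'.1⟩ hp.2 fun h => hze h.symm,
        adj_of_p3_edge hH hca he.1 he.2.2 hne hzq ⟨hz'.2.2, hz'.1⟩ hq.2 fun h => hze h.symm⟩
    have k1 := key x hx' hzx
    have k2 := key _ hπ hzπ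
    exact hH.k4 (hM.partner x hx).2 k1.1 k1.2 k2.1 k2.2 hpq
  obtain ⟨p, hp⟩ := Finset.card_pos.1 (by omega : 0 < Q.card)
  have hpq := (hM'.partner p hp).2
  have hp' := hM'.subset_right hp
  have hq' := hM'.subset_left (hM'.partner p hp).1
  have hr₂z₁ : ¬ H.Adj r₂ z₁ := fun h => hZ z₁ hz₁ z₂ hz₂ <|
    adj_trans_of_edge hH hab ⟨hz₁'.1, hz₁'.2.1⟩ hr₂'.2 ⟨hz₂'.1, hz₂'.2.1⟩ h.symm h₂.symm hne
  have hxr : H.Adj r₂ x₁ := adj_of_p3_edge hH hbc hr₂'.1 hr₂'.2.2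
    (by rintro rfl; exact hr₂'.2.1 hab) h₁ hz₁'.2 hx₁'.2 hr₂z₁
  have key : ∀ e ∈ Private H b c a, ¬ H.Adj z₁ e → ¬ H.Adj z₂ e → H.Adj e x₁ ∧ H.Adj e r₂ := by
    intro e he h1 h2
    rw [mem_private] at he
    refine ⟨adj_of_p3_edge hH hbc.symm he.1 he.2.1 ?_ h₁ ⟨hz₁'.2.2, hz₁'.2.1⟩
      ⟨hx₁'.2.2, hx₁'.2.1⟩ fun h => h1 h.symm, adj_of_p3_edge hH hab he.1 he.2.2 ?_ h₂
      ⟨hz₂'.1, hz₂'.2.1⟩ hr₂'.2 fun h => h2 h.symm⟩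
    · rintro rfl
      exact he.2.2 hca.symm
    · rintro rfl
      exact he.2.1 hca
  have k1 := key p hp' (huntouched _ hz₁ p hp' _ hq' hpq) (huntouched _ hz₂ p hp' _ hq' hpq)
  have k2 := key _ hq' (huntouched _ hz₁ _ hq' p hp' hpq.symm)
    (huntouched _ hz₂ _ hq' p hp' hpq.symm)
  exact hH.k4 hpq k1.1 k1.2 k2.1 k2.2 hxr.symm

/-- The numerical information extracted from an edge between the two sets of common neighbours
at one vertex of a triangle: `m`, `i` count the matched and the independent private neighbours,
`s` and `t` the common neighbours. -/
def HubBound (α m i s t : ℕ) : Prop :=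
  m + 2 ≤ α ∧ (m + 2 = α → i + 2 ≤ α) ∧
    (3 ≤ m → (s + m + 1 ≤ α ∨ m = 3 ∧ s ≤ 4) ∧ (t + m + 1 ≤ α ∨ m = 3 ∧ t ≤ 4))

set_option maxHeartbeats 4000000 in
theorem sum_le_seven_mul {α ta tb tc ia ib ic ma mb mc z : ℕ}
    (hta : ta + 1 ≤ α) (htb : tb + 1 ≤ α) (htc : tc + 1 ≤ α)
    (hia : ia + 1 ≤ α) (hib : ib + 1 ≤ α) (hic : ic + 1 ≤ α) (hz : z + 1 ≤ α)
    (hma : ma ≤ ia) (hmb : mb ≤ ib) (hmc : mc ≤ ic)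
    (hb : 0 < ta + tc → mb + 2 ≤ α) (hc : 0 < tb + ta → mc + 2 ≤ α)
    (ea : tc + tb ≤ α ∨ HubBound α ma ia tc tb) (eb : ta + tc ≤ α ∨ HubBound α mb ib ta tc)
    (ec : tb + ta ≤ α ∨ HubBound α mc ic tb ta)
    (hall : ta + tb + tc ≤ α ∨ HubBound α ma ia tc tb ∨ HubBound α mb ib ta tc ∨
      HubBound α mc ic tb ta)
    (fa : 2 ≤ ma → 2 ≤ mb → ia + z ≤ α ∨ ic + z ≤ α)
    (fb : 2 ≤ mb → 2 ≤ mc → ib + z ≤ α ∨ ia + z ≤ α)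
    (fc : 2 ≤ mc → 2 ≤ ma → ic + z ≤ α ∨ ib + z ≤ α) :
    3 + (ta + tb + tc) + (ia + ma + (ib + mb) + (ic + mc)) + z ≤ 7 * α := by
  have hf : (ia + z ≤ α ∨ ib + z ≤ α ∨ ic + z ≤ α) ∨ ma ≤ 1 ∧ mb ≤ 1 ∨ mb ≤ 1 ∧ mc ≤ 1 ∨
      mc ≤ 1 ∧ ma ≤ 1 := by omega
  clear fa fb fc
  by_contra hcon
  rcases hf with (hf | hf | hf) | hf | hf | hf <;>
  by_cases h3 : 3 ≤ ma <;> by_cases h3' : 3 ≤ mb <;> by_cases h3'' : 3 ≤ mc <;>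
    simp only [HubBound, h3, h3', h3'', forall_const, false_implies, and_true]
      at ea eb ec hall <;> omega

theorem common_facts [Fintype V] (hH : Sparse H α) (hab : H.Adj a b) (hbc : H.Adj b c)
    (hca : H.Adj c a) : Independent H (Common H a b c) ∧ (Common H a b c).card + 1 ≤ α ∧
      Disjoint (Common H a b c) (Common H c a b) := by
  have hi : Independent H (Common H a b c) := by
    intro x hx y hy hxy
    rw [mem_common] at hx hy
    exact hH.k4 hab hx.1 hy.1 hx.2.1 hy.2.1 hxy
  have hc : ∀ x ∈ Common H a b c, ¬ H.Adj c x := by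
    intro x hx hcx
    rw [mem_common] at hx
    exact hH.k4 hab hca.symm hx.1 hbc hx.2.1 hcx
  refine ⟨hi, card_succ_le hH hi (fun h => (mem_common.1 h).2.2 rfl) hc, ?_⟩
  exact Finset.disjoint_left.2 fun x hx hx' => hc x hx (mem_common.1 hx').1

theorem exists_hub_bounds [Fintype V] (hH : Sparse H α) (hab : H.Adj a b) (hbc : H.Adj b c)
    (hca : H.Adj c a) : ∃ I R π, Matched H (Private H a b c) I R π ∧ I.card + 1 ≤ α ∧
      R.card ≤ I.card ∧ (0 < (Common H a b c).card + (Common H c a b).card → R.card + 2 ≤ α) ∧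
      ((∀ u ∈ Common H a b c, ∀ w ∈ Common H c a b, ¬ H.Adj u w) ∨
        HubBound α R.card I.card (Common H a b c).card (Common H c a b).card) := by
  have hX := fun v (hv : v ∈ Private H a b c) => mem_private.1 hv
  have hS := fun v (hv : v ∈ Common H a b c) => mem_common.1 hv
  have hT := fun v (hv : v ∈ Common H c a b) => mem_common.1 hv
  obtain ⟨I, R, π, hM⟩ := exists_matched (p3Free_of_edge hH hbc fun v hv => (hX v hv).2)
    fun x hx y hy z hz hxy hyz hxz => hH.k4 (hX x hx).1 (hX y hy).1 (hX z hz).1 hxy hxz hyz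
  have hI := fun x hx => hX x (hM.subset_left hx)
  refine ⟨I, R, π, hM, card_succ_le hH hM.indep (fun h => (hI b h).2.2 hbc.symm)
    fun x hx => (hI x hx).2.1, ?_, ?_, ?_⟩
  · refine Finset.card_le_card_of_injOn π (fun x hx => (hM.partner x hx).1) ?_
    intro x hx y hy hxy
    by_contra hne
    have := hM.sep x hx y hy hne
    have := (hM.partner x hx).2
    simp_all
  · intro hpos
    have hW := windmill_insert hab hbc hca hX hM
    have hbR : b ∉ R := fun hb => (hX b (hM.subset_right hb)).2.2 hbc.symm
    have hsplit : ∃ u, Splits H a (insert b R) (Function.update π b c) u := by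
      by_cases h : 0 < (Common H a b c).card
      · obtain ⟨u, hu⟩ := Finset.card_pos.1 h
        exact ⟨u, splits_insert hH hab hbc hca hX hM (hS u hu).1 (Or.inl (hS u hu).2)⟩
      · obtain ⟨u, hu⟩ := Finset.card_pos.1 (by omega : 0 < (Common H c a b).card)
        exact ⟨u, splits_insert hH hab hbc hca hX hM (hT u hu).2.1
          (Or.inr ⟨(hT u hu).1, (hT u hu).2.2⟩)⟩
    obtain ⟨u, hu⟩ := hsplit
    have := card_add_card_le_of_same (S := {u}) (u := u) hH hW (by simp [Independent])
      (by simpa using hu) (by simp)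
    rw [Finset.card_insert_of_notMem hbR, Finset.card_singleton] at this
    omega
  · by_cases h : ∃ u ∈ Common H a b c, ∃ w ∈ Common H c a b, H.Adj u w
    · obtain ⟨u, hu, w, hw, huw⟩ := h
      exact Or.inr (bounds_of_cross_edge hH hab hbc hca hX hM hS hT hu hw huw)
    · push Not at h
      exact Or.inl h

theorem card_private_le_one [Fintype V] (hH : Sparse H α) (hab : H.Adj a b) (hbc : H.Adj b c)
    {z z' : V} (hz : ¬ H.Adj a z ∧ ¬ H.Adj b z ∧ ¬ H.Adj c z)
    (hz' : ¬ H.Adj a z' ∧ ¬ H.Adj b z' ∧ ¬ H.Adj c z') (hzz : H.Adj z z') :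
    (Private H a b c).card ≤ 1 := by
  have hadj : ∀ x ∈ Private H a b c, H.Adj x z ∧ H.Adj x z' := by
    intro x hx
    rw [mem_private] at hx
    have h1 : H.Adj x z ∨ H.Adj x z' := by
      have := hH.p3p2 (p := x) (by rintro rfl; exact hx.2.2 hbc.symm) hx.1.symm hab
        (fun h => hx.2.1 h.symm) hzz
      tauto
    have hne : ∀ y, ¬ H.Adj a y → x ≠ y := by
      rintro y hy rfl
      exact hy hx.1
    rcases h1 with h1 | h1
    · exact ⟨h1, adj_trans_of_edge hH hbc hx.2 hz.2 hz'.2 h1 hzz (hne _ hz'.1)⟩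
    · exact ⟨adj_trans_of_edge hH hbc hx.2 hz'.2 hz.2 h1 hzz.symm (hne _ hz.1), h1⟩
  rw [Finset.card_le_one]
  intro x hx y hy
  by_contra hxy
  have h1 := hadj x hx
  have h2 := hadj y hy
  exact hH.k4 (adj_trans_of_edge hH hbc (mem_private.1 hx).2 hz.2 (mem_private.1 hy).2 h1.1
    h2.1.symm hxy) h1.1 h1.2 h2.1 h2.2 hzz

theorem card_le_of_triangle [Fintype V] (hH : Sparse H α) (hab : H.Adj a b) (hbc : H.Adj b c)
    (hca : H.Adj c a) : Fintype.card V ≤ 7 * α := by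
  set Z : Finset V :=
    Finset.univ.filter fun v => ¬ H.Adj a v ∧ ¬ H.Adj b v ∧ ¬ H.Adj c v with hZdef
  have hZt : ∀ z ∈ Z, ¬ H.Adj a z ∧ ¬ H.Adj b z ∧ ¬ H.Adj c z := fun z hz =>
    (Finset.mem_filter.1 hz).2
  have haZ : a ∉ Z := fun h => (hZt a h).2.2 hca
  have hcover : Fintype.card V ≤ 3 + ((Common H b c a).card + (Common H c a b).card +
      (Common H a b c).card) + ((Private H a b c).card + (Private H b c a).card +
      (Private H c a b).card) + Z.card := by
    have hsub : (Finset.univ : Finset V) ⊆ {a, b, c} ∪ (Common H b c a ∪ Common H c a b ∪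
        Common H a b c) ∪ (Private H a b c ∪ Private H b c a ∪ Private H c a b) ∪ Z := by
      intro v _
      simp only [Finset.mem_union, Finset.mem_insert, Finset.mem_singleton, mem_common, mem_private,
        hZdef, Finset.mem_filter, Finset.mem_univ, true_and]
      tauto
    refine (Finset.card_le_card hsub).trans ((Finset.card_union_le _ _).trans ?_)
    gcongr
    refine (Finset.card_union_le _ _).trans ?_
    gcongr
    · refine (Finset.card_union_le _ _).trans ?_
      gcongr
      · exact Finset.card_le_three
      · refine (Finset.card_union_le _ _).trans ?_
        gcongr
        exact Finset.card_union_le _ _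
    · refine (Finset.card_union_le _ _).trans ?_
      gcongr
      exact Finset.card_union_le _ _
  have hA := common_facts hH hab hbc hca
  have hB := common_facts hH hbc hca hab
  have hC := common_facts hH hca hab hbc
  by_cases hZ : Independent H Z
  · have hz := card_succ_le hH hZ haZ fun z hz => (hZt z hz).1
    obtain ⟨I, R, π, hM, h1, h2, -, h4⟩ := exists_hub_bounds hH hab hbc hca
    obtain ⟨J, Q, ρ, hM', h1', h2', h3', h4'⟩ := exists_hub_bounds hH hbc hca hab
    obtain ⟨L, N, σ, hM'', h1'', h2'', h3'', h4''⟩ := exists_hub_bounds hH hca hab hbc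
    have hsum : ∀ {S T : Finset V}, Independent H S → Independent H T → Disjoint S T →
        (∀ s ∈ S, ∀ t ∈ T, ¬ H.Adj s t) → S.card + T.card ≤ α := by
      intro S T hS hT hd hST
      rw [← Finset.card_union_of_disjoint hd]
      exact hH.card_le _ (hS.union hT hST)
    have e := h4.imp_left (hsum hA.1 hC.1 hA.2.2)
    have e' := h4'.imp_left (hsum hB.1 hA.1 hB.2.2)
    have e'' := h4''.imp_left (hsum hC.1 hB.1 hC.2.2)
    have hall : (Common H b c a).card + (Common H c a b).card + (Common H a b c).card ≤ α ∨
        HubBound α R.card I.card (Common H a b c).card (Common H c a b).card ∨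
        HubBound α Q.card J.card (Common H b c a).card (Common H a b c).card ∨
        HubBound α N.card L.card (Common H c a b).card (Common H b c a).card := by
      rcases h4 with h4 | h4
      · rcases h4' with h4' | h4'
        · rcases h4'' with h4'' | h4''
          · left
            have hd := Finset.disjoint_union_left.2 ⟨hB.2.2, hA.2.2.symm⟩
            have := hsum ((hB.1).union hC.1 fun s hs t ht h => h4'' t ht s hs h.symm) hA.1 hd ?_
            · rwa [Finset.card_union_of_disjoint hC.2.2.symm] at this
            · intro s hs t ht hst
              rcases Finset.mem_union.1 hs with hs | hs
              · exact h4' s hs t ht hst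
              · exact h4 t ht s hs hst.symm
          · exact Or.inr (Or.inr (Or.inr h4''))
        · exact Or.inr (Or.inr (Or.inl h4'))
      · exact Or.inr (Or.inl h4)
    have f := remote_card_bound hH hab hbc hca hM hM' hM'' hZ hZt
    have f' := remote_card_bound hH hbc hca hab hM' hM'' hM hZ fun z hz =>
      ⟨(hZt z hz).2.1, (hZt z hz).2.2, (hZt z hz).1⟩
    have f'' := remote_card_bound hH hca hab hbc hM'' hM hM' hZ fun z hz =>
      ⟨(hZt z hz).2.2, (hZt z hz).1, (hZt z hz).2.1⟩
    rw [hM.card_eq, hM'.card_eq, hM''.card_eq] at hcover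
    exact hcover.trans (sum_le_seven_mul hB.2.1 hC.2.1 hA.2.1 h1 h1' h1'' hz h2 h2' h2'' h3' h3''
      e e' e'' hall f f' f'')
  · unfold Independent at hZ
    push Not at hZ
    obtain ⟨z, hz, z', hz', hzz⟩ := hZ
    have t := hZt z hz
    have t' := hZt z' hz'
    have p1 := card_private_le_one hH hab hbc t t' hzz
    have p2 := card_private_le_one (c := a) hH hbc hca ⟨t.2.1, t.2.2, t.1⟩
      ⟨t'.2.1, t'.2.2, t'.1⟩ hzz
    have p3 := card_private_le_one (c := b) hH hca hab ⟨t.2.2, t.1, t.2.1⟩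
      ⟨t'.2.2, t'.1, t'.2.1⟩ hzz
    obtain ⟨I, hIZ, hI, hle⟩ := exists_independent_card_le_three_mul hH
      (p3Free_of_edge (S := Z) hH hab fun v hv => ⟨(hZt v hv).1, (hZt v hv).2.1⟩)
    have := card_succ_le hH hI (fun h => haZ (hIZ h)) fun v hv => (hZt v (hIZ hv)).1
    omega

theorem Sparse.card_le_seven_mul [Fintype V] (hH : Sparse H α) : Fintype.card V ≤ 7 * α := by
  by_cases htri : ∃ a b c, H.Adj a b ∧ H.Adj b c ∧ H.Adj c a
  · obtain ⟨a, b, c, hab, hbc, hca⟩ := htri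
    exact card_le_of_triangle hH hab hbc hca
  · push Not at htri
    by_cases hedge : ∃ u v, H.Adj u v
    · obtain ⟨u, v, huv⟩ := hedge
      have hN : ∀ x, (Finset.univ.filter fun y => H.Adj x y).card ≤ α := by
        intro x
        refine hH.card_le _ fun y hy z hz hyz => ?_
        exact htri x y z (Finset.mem_filter.1 hy).2 hyz (Finset.mem_filter.1 hz).2.symm
      obtain ⟨I, -, hI, hle⟩ := exists_independent_card_le_three_mul hH
        (p3Free_of_edge (S := Finset.univ.filter fun y => ¬ H.Adj u y ∧ ¬ H.Adj v y) hH huv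
          fun y hy => (Finset.mem_filter.1 hy).2)
      have hsub : (Finset.univ : Finset V) ⊆ (Finset.univ.filter fun y => H.Adj u y) ∪
          (Finset.univ.filter fun y => H.Adj v y) ∪
          Finset.univ.filter fun y => ¬ H.Adj u y ∧ ¬ H.Adj v y := by
        intro y _
        simp only [Finset.mem_union, Finset.mem_filter, Finset.mem_univ, true_and]
        tauto
      have h1 := Finset.card_le_card hsub
      have h2 := Finset.card_union_le ((Finset.univ.filter fun y => H.Adj u y) ∪
        (Finset.univ.filter fun y => H.Adj v y))
        (Finset.univ.filter fun y => ¬ H.Adj u y ∧ ¬ H.Adj v y)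
      have h3 := Finset.card_union_le (Finset.univ.filter fun y => H.Adj u y)
        (Finset.univ.filter fun y => H.Adj v y)
      have h4 := hH.card_le I hI
      have h5 := hN u
      have h6 := hN v
      rw [Finset.card_univ] at h1
      omega
    · push Not at hedge
      have := hH.card_le Finset.univ fun x _ y _ => hedge x y
      rw [Finset.card_univ] at this
      omega

end

theorem card_le_seven_mul_cliqueNum {V : Type*} [Fintype V] (G : SimpleGraph V)
    (h1 : ¬ Contains G (⊥ : SimpleGraph (Fin 4))) (h2 : ¬ Contains G P3P2ᶜ) :
    Fintype.card V ≤ 7 * G.cliqueNum := by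
  exact (sparse_compl G h1 h2).card_le_seven_mul
end
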